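/- arXiv:2312.17610 — 6 statements merged into one kernel-verified Lean document; each statement's English description precedes it below -/
import Mathlib

section
/- There exists a constant C > 0 depending only on m such that for every α ∈ [0,1), every admissible ω, and all r > 0 and θ ∈ (0, π/m), one has |u^r(r,θ)| ≤ (C/(1−α)) · r · ‖(s+φ)^α w‖_∞. (Lemma 4.1, radial component: the velocity field generated by such vorticity vanishes at least linearly at the origin.) -/
open Real MeasureTheory

noncomputable section

/-- Polar representation `w(s,φ) = ω(s cos φ, s sin φ)` of a function on `ℝ²`. -/
def polarRep (ω : ℝ × ℝ → ℝ) (s φ : ℝ) : ℝ := ω (s * Real.cos φ, s * Real.sin φ)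

/-- An admissible vorticity: a Schwartz function on `ℝ²` whose polar representation is
odd in `φ` and `2π/m`-periodic in `φ`. -/
def IsAdmissible (m : ℕ) (ω : SchwartzMap (ℝ × ℝ) ℝ) : Prop :=
  (∀ s φ : ℝ, polarRep (⇑ω) s (-φ) = -polarRep (⇑ω) s φ) ∧
  (∀ s φ : ℝ, polarRep (⇑ω) s (φ + 2 * π / m) = polarRep (⇑ω) s φ)

/-- Weighted sup norm `‖(s+φ)^β h‖_∞ = sup_{s>0, 0<φ<π/m} (s+φ)^β |h(s,φ)|`. -/
def wnorm (m : ℕ) (β : ℝ) (h : ℝ → ℝ → ℝ) : ℝ :=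
  sSup {y : ℝ | ∃ s φ : ℝ, 0 < s ∧ φ ∈ Set.Ioo 0 (π / m) ∧ y = (s + φ) ^ β * |h s φ|}

/-- `k`-th partial derivative in the first (radial) variable. -/
def dS (k : ℕ) (w : ℝ → ℝ → ℝ) : ℝ → ℝ → ℝ := fun s φ => iteratedDeriv k (fun t => w t φ) s

/-- `k`-th partial derivative in the second (angular) variable. -/
def dPhi (k : ℕ) (w : ℝ → ℝ → ℝ) : ℝ → ℝ → ℝ := fun s φ => iteratedDeriv k (fun t => w s t) φ

/-- Radial velocity component `u^r` given by the singular-kernel integral (4.2). -/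
def ur (m : ℕ) (w : ℝ → ℝ → ℝ) (r θ : ℝ) : ℝ :=
  (m ^ 2 / (2 * π)) * ∫ s in Set.Ioi (0 : ℝ), ∫ φ in Set.Ioo (0 : ℝ) (π / m),
    Real.sin ((m : ℝ) * (φ - θ)) * w s φ * (s / r) ^ (-(m : ℤ)) /
        (1 - 2 * (s / r) ^ (-(m : ℤ)) * Real.cos ((m : ℝ) * (φ - θ)) +
          (s / r) ^ (-(2 * m : ℤ))) * (s / r)

/-- Outer part `U₁^θ` of the angular velocity (4.3). -/
def uthetaOuter (m : ℕ) (w : ℝ → ℝ → ℝ) (r θ : ℝ) : ℝ :=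
  (m ^ 2 / (2 * π)) * ∫ s in Set.Ioi r, ∫ φ in Set.Ioo (-(π / m)) (π / m),
    w s φ * ((s / r) ^ (-(m : ℤ)) - Real.cos ((m : ℝ) * (φ - θ))) /
        (1 - 2 * (s / r) ^ (-(m : ℤ)) * Real.cos ((m : ℝ) * (φ - θ)) +
          (s / r) ^ (-(2 * m : ℤ))) * (s / r) ^ (-(m : ℤ)) * (s / r)

/-- Inner part `U₂^θ` of the angular velocity (4.4). -/
def uthetaInner (m : ℕ) (w : ℝ → ℝ → ℝ) (r θ : ℝ) : ℝ :=
  (m ^ 2 / (2 * π)) * ∫ s in Set.Ioo (0 : ℝ) r, ∫ φ in Set.Ioo (-(π / m)) (π / m),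
    w s φ * (Real.cos ((m : ℝ) * (φ - θ)) - (s / r) ^ (m : ℤ)) /
        (1 - 2 * (s / r) ^ (m : ℤ) * Real.cos ((m : ℝ) * (φ - θ)) +
          (s / r) ^ (2 * m : ℤ)) * (s / r) ^ (m : ℤ) * (s / r)

/-- Angular velocity component `u^θ = U₁^θ + U₂^θ`. -/
def utheta (m : ℕ) (w : ℝ → ℝ → ℝ) (r θ : ℝ) : ℝ :=
  uthetaOuter m w r θ + uthetaInner m w r θ

end

/-- The set defining the weighted sup norm of a Schwartz vorticity is bounded above. -/
lemma bddAbove_wnorm {m : ℕ} (hm : 3 ≤ m) {α : ℝ} (h0 : 0 ≤ α) (h1 : α < 1)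
    (ω : SchwartzMap (ℝ × ℝ) ℝ) :
    BddAbove {y : ℝ | ∃ s φ : ℝ, 0 < s ∧ φ ∈ Set.Ioo 0 (π / m) ∧
      y = (s + φ) ^ α * |polarRep ω s φ|} := by
  obtain ⟨A, -, hA⟩ := ω.decay 0 0
  obtain ⟨B, -, hB⟩ := ω.decay 1 0
  simp only [norm_iteratedFDeriv_zero, pow_zero, one_mul, pow_one, Real.norm_eq_abs] at hA hB
  refine ⟨5 * A + 2 * B, ?_⟩
  rintro y ⟨s, φ, hs, ⟨hφ0, hφ1⟩, rfl⟩
  have hm' : (3 : ℝ) ≤ m := by exact_mod_cast hm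
  have hφ : φ ≤ 4 := by
    have : π / m ≤ π := div_le_self pi_pos.le (by linarith)
    linarith [pi_le_four]
  have hpow : (s + φ) ^ α ≤ 1 + s + φ :=
    calc (s + φ) ^ α ≤ (1 + s + φ) ^ α := by gcongr; linarith
      _ ≤ (1 + s + φ) ^ (1 : ℝ) := rpow_le_rpow_of_exponent_le (by linarith) h1.le
      _ = 1 + s + φ := rpow_one _
  set p : ℝ × ℝ := (s * cos φ, s * sin φ) with hp
  have hsp : s ≤ 2 * ‖p‖ := by
    have hfst : s * |cos φ| ≤ ‖p‖ := by
      simp [hp, abs_of_pos hs]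
    have hsnd : s * |sin φ| ≤ ‖p‖ := by
      simp [hp, abs_of_pos hs]
    have hcs : 1 ≤ |cos φ| + |sin φ| := by
      nlinarith [abs_cos_le_one φ, abs_sin_le_one φ, abs_nonneg (cos φ), abs_nonneg (sin φ),
        sq_abs (cos φ), sq_abs (sin φ), sin_sq_add_cos_sq φ]
    nlinarith
  have hω := abs_nonneg (ω p)
  calc (s + φ) ^ α * |polarRep ω s φ| ≤ (5 + 2 * ‖p‖) * |ω p| :=
        mul_le_mul_of_nonneg_right (by linarith) hω
    _ = 5 * |ω p| + 2 * (‖p‖ * |ω p|) := by ring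
    _ ≤ 5 * A + 2 * B := by linarith [hA p, hB p]

/-- The rescaled kernel, with `t` standing for `s / r` and `ψ` for `m (φ - θ)`. -/
noncomputable def radialKernel (m : ℕ) (t ψ : ℝ) : ℝ :=
  |sin ψ| * (t ^ m * t) / ((t ^ m - cos ψ) ^ 2 + |sin ψ| ^ 2)

lemma radialKernel_nonneg (m : ℕ) {t : ℝ} (ht : 0 ≤ t) (ψ : ℝ) : 0 ≤ radialKernel m t ψ := by
  unfold radialKernel; positivity

lemma abs_integrand_eq (m : ℕ) {t : ℝ} (ht : 0 < t) (ψ w : ℝ) :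
    |sin ψ * w * t ^ (-(m : ℤ)) / (1 - 2 * t ^ (-(m : ℤ)) * cos ψ + t ^ (-(2 * m : ℤ))) * t| =
      radialKernel m t ψ * |w| := by
  have hx : 0 < t ^ m := pow_pos ht m
  have h1 : t ^ (-(m : ℤ)) = (t ^ m)⁻¹ := by simp [zpow_neg]
  have h2 : t ^ (-(2 * m : ℤ)) = ((t ^ m) ^ 2)⁻¹ := by
    rw [zpow_neg, ← pow_mul, mul_comm m 2]; norm_cast
  rw [h1, h2, radialKernel, sq_abs]
  set x := t ^ m
  have hD : 1 - 2 * x⁻¹ * cos ψ + (x ^ 2)⁻¹ = ((x - cos ψ) ^ 2 + sin ψ ^ 2) / x ^ 2 := by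
    rw [eq_div_iff (by positivity)]
    field_simp
    linear_combination -sin_sq_add_cos_sq ψ
  have hD0 : 0 ≤ (x - cos ψ) ^ 2 + sin ψ ^ 2 := by positivity
  rw [hD, abs_mul, abs_div, abs_mul, abs_mul, abs_div, abs_of_nonneg hD0, abs_of_pos ht,
    abs_of_pos (inv_pos.2 hx), abs_of_pos (pow_pos hx 2)]
  rcases hD0.eq_or_lt with h | h
  · simp [← h]
  · field_simp

/-- The kernel is dominated by an explicit derivative. -/
lemma radialKernel_le {m : ℕ} (hm : 3 ≤ m) {t : ℝ} (ht : 0 < t) {ψ : ℝ} (hψ : sin ψ ≠ 0) :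
    radialKernel m t ψ ≤
      4 * (1 / (1 + ((t ^ m - cos ψ) / |sin ψ|) ^ 2) * (m * t ^ (m - 1) / |sin ψ|)) +
        5 * (1 / (1 + t ^ 2)) := by
  have hσ : 0 < |sin ψ| := abs_pos.2 hψ
  have hσ1 : |sin ψ| ≤ 1 := abs_sin_le_one ψ
  have hm' : (3 : ℝ) ≤ m := by exact_mod_cast hm
  have hc : cos ψ ≤ 1 := cos_le_one ψ
  rw [radialKernel]
  set σ := |sin ψ|
  set c := cos ψ
  have hform : 1 / (1 + ((t ^ m - c) / σ) ^ 2) * (m * t ^ (m - 1) / σ) =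
      σ * (m * t ^ (m - 1)) / ((t ^ m - c) ^ 2 + σ ^ 2) := by
    field_simp
    ring
  rw [hform]
  rcases le_total t 2 with h2 | h2
  · have hx : t ^ m = t ^ (m - 1) * t := by rw [← pow_succ]; congr 1; omega
    have hle : t ^ m * t ≤ 4 * (m * t ^ (m - 1)) := by
      have hp : 0 < t ^ (m - 1) := by positivity
      have ht4 : t * t ≤ 4 * m := by nlinarith
      rw [hx]
      nlinarith
    calc σ * (t ^ m * t) / ((t ^ m - c) ^ 2 + σ ^ 2)
        ≤ σ * (4 * (m * t ^ (m - 1))) / ((t ^ m - c) ^ 2 + σ ^ 2) := by gcongr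
      _ = 4 * (σ * (m * t ^ (m - 1)) / ((t ^ m - c) ^ 2 + σ ^ 2)) := by ring
      _ ≤ _ := le_add_of_nonneg_right (by positivity)
  · have hx3 : t ^ 3 ≤ t ^ m := pow_le_pow_right₀ (by linarith) hm
    have ht2 : 4 ≤ t ^ 2 := by nlinarith
    have hx2 : 2 ≤ t ^ 3 := by nlinarith
    refine le_trans ?_ (le_add_of_nonneg_left (by positivity))
    rw [mul_one_div, div_le_div_iff₀ (by positivity) (by positivity)]
    set x := t ^ m
    have hx : 0 < x := by linarith
    have hsq : x ^ 2 / 4 ≤ (x - c) ^ 2 := by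
      have : x / 2 ≤ x - c := by linarith
      nlinarith
    calc σ * (x * t) * (1 + t ^ 2) ≤ 1 * (x * t) * (5 / 4 * t ^ 2) := by gcongr; linarith
      _ = 5 / 4 * x * t ^ 3 := by ring
      _ ≤ 5 / 4 * x * x := by gcongr
      _ ≤ 5 * ((x - c) ^ 2 + σ ^ 2) := by nlinarith [sq_nonneg σ]

/-- The radial integral of the kernel is bounded uniformly in the angle. -/
lemma lintegral_radialKernel_le {m : ℕ} (hm : 3 ≤ m) {r : ℝ} (hr : 0 < r) (ψ : ℝ) :
    ∫⁻ s in Set.Ioi (0 : ℝ), ENNReal.ofReal (radialKernel m (s / r) ψ) ≤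
      ENNReal.ofReal (9 * π * r) := by
  by_cases hψ : sin ψ = 0
  · simp [radialKernel, hψ]
  have hσ : 0 < |sin ψ| := abs_pos.2 hψ
  let F : ℝ → ℝ := fun t => 4 * arctan ((t ^ m - cos ψ) / |sin ψ|) + 5 * arctan t
  let f : ℝ → ℝ := fun t =>
      4 * (1 / (1 + ((t ^ m - cos ψ) / |sin ψ|) ^ 2) * (m * t ^ (m - 1) / |sin ψ|)) +
        5 * (1 / (1 + t ^ 2))
  have hF : ∀ t, HasDerivAt F (f t) t := fun t =>
    ((((hasDerivAt_pow m t).sub_const (cos ψ)).div_const |sin ψ|).arctan.const_mul 4).add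
      ((hasDerivAt_arctan t).const_mul 5)
  have hG : ∀ s, HasDerivAt (fun s => r * F (s / r)) (f (s / r)) s := fun s => by
    have := ((hF (s / r)).comp s ((hasDerivAt_id s).div_const r)).const_mul r
    exact this.congr_deriv (by field_simp)
  have hf0 : ∀ s ∈ Set.Ioi (0 : ℝ), 0 ≤ f (s / r) := fun s hs => by
    have : 0 < s / r := div_pos hs hr
    positivity
  have hlim : Filter.Tendsto (fun s => r * F (s / r)) Filter.atTop
      (nhds (r * (4 * (π / 2) + 5 * (π / 2)))) := by
    have hdiv : Filter.Tendsto (fun s : ℝ => s / r) Filter.atTop Filter.atTop :=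
      Filter.tendsto_id.atTop_div_const hr
    have harc : Filter.Tendsto arctan Filter.atTop (nhds (π / 2)) :=
      tendsto_arctan_atTop.mono_right nhdsWithin_le_nhds
    have hpow : Filter.Tendsto (fun t : ℝ => (t ^ m - cos ψ) / |sin ψ|)
        Filter.atTop Filter.atTop := by
      refine Filter.Tendsto.atTop_div_const hσ ?_
      exact Filter.tendsto_atTop_add_const_right _ _ (Filter.tendsto_pow_atTop (by omega))
    exact ((((harc.comp hpow).const_mul 4).add (harc.const_mul 5)).comp hdiv).const_mul r
  have hcont := (hG 0).continuousAt.continuousWithinAt (s := Set.Ici 0)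
  have hInt := integrableOn_Ioi_deriv_of_nonneg hcont (fun s _ => hG s) hf0 hlim
  have heq := integral_Ioi_of_hasDerivAt_of_nonneg hcont (fun s _ => hG s) hf0 hlim
  calc ∫⁻ s in Set.Ioi (0 : ℝ), ENNReal.ofReal (radialKernel m (s / r) ψ)
      ≤ ∫⁻ s in Set.Ioi (0 : ℝ), ENNReal.ofReal (f (s / r)) :=
        setLIntegral_mono' measurableSet_Ioi fun s hs =>
          ENNReal.ofReal_le_ofReal (radialKernel_le hm (div_pos hs hr) hψ)
    _ = ENNReal.ofReal (∫ s in Set.Ioi (0 : ℝ), f (s / r)) :=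
        (ofReal_integral_eq_lintegral_ofReal hInt
          (ae_restrict_of_forall_mem measurableSet_Ioi hf0)).symm
    _ ≤ ENNReal.ofReal (9 * π * r) := by
        refine ENNReal.ofReal_le_ofReal ?_
        rw [heq]
        have h0 : -(2 * π) ≤ F (0 / r) := by
          have := neg_pi_div_two_lt_arctan (((0 / r) ^ m - cos ψ) / |sin ψ|)
          simp only [F, zero_div, arctan_zero] at this ⊢
          linarith
        nlinarith [mul_le_mul_of_nonneg_left h0 hr.le, mul_pos hr pi_pos]

/-- Integral of the angular weight `φ ^ (-α)`. -/
lemma lintegral_rpow_neg_le {a α : ℝ} (ha : 0 ≤ a) (ha2 : a ≤ 2) (h0 : 0 ≤ α) (h1 : α < 1) :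
    ∫⁻ φ in Set.Ioo 0 a, ENNReal.ofReal (φ ^ (-α)) ≤ ENNReal.ofReal (2 / (1 - α)) := by
  have hInt : IntegrableOn (fun φ : ℝ => φ ^ (-α)) (Set.Ioc 0 a) :=
    (intervalIntegral.intervalIntegrable_rpow' (by linarith)).1
  calc ∫⁻ φ in Set.Ioo 0 a, ENNReal.ofReal (φ ^ (-α))
      ≤ ∫⁻ φ in Set.Ioc 0 a, ENNReal.ofReal (φ ^ (-α)) :=
        lintegral_mono_set Set.Ioo_subset_Ioc_self
    _ = ENNReal.ofReal (∫ φ in Set.Ioc 0 a, φ ^ (-α)) :=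
        (ofReal_integral_eq_lintegral_ofReal hInt
          (ae_restrict_of_forall_mem measurableSet_Ioc fun φ hφ => rpow_nonneg hφ.1.le _)).symm
    _ ≤ ENNReal.ofReal (2 / (1 - α)) := by
        refine ENNReal.ofReal_le_ofReal ?_
        have hα : 0 < 1 - α := by linarith
        rw [← intervalIntegral.integral_of_le ha, integral_rpow (Or.inl (by linarith)),
          neg_add_eq_sub, zero_rpow hα.ne', sub_zero]
        gcongr
        calc a ^ (1 - α) ≤ 2 ^ (1 - α) := by gcongr
          _ ≤ 2 ^ (1 : ℝ) := rpow_le_rpow_of_exponent_le (by norm_num) (by linarith)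
          _ = 2 := rpow_one 2

/-- **Lemma 4.1, radial component.** Linear vanishing of `u^r` at the origin. -/
theorem ur_linear_growth (m : ℕ) (hm : 3 ≤ m) :
    ∃ C : ℝ, 0 < C ∧ ∀ α : ℝ, 0 ≤ α → α < 1 →
      ∀ ω : SchwartzMap (ℝ × ℝ) ℝ, IsAdmissible m ω →
        ∀ r θ : ℝ, 0 < r → θ ∈ Set.Ioo 0 (π / m) →
          |ur m (polarRep ⇑ω) r θ| ≤ C / (1 - α) * r * wnorm m α (polarRep ⇑ω) := by
  have hm' : (3 : ℝ) ≤ m := by exact_mod_cast hm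
  refine ⟨9 * m ^ 2, by positivity, fun α h0 h1 ω _ r θ hr _ => ?_⟩
  set w := polarRep ω
  set M := wnorm m α w
  have hbdd := bddAbove_wnorm hm h0 h1 ω
  have hM0 : 0 ≤ M := Real.sSup_nonneg (by
    rintro y ⟨s, φ, hs, hφ, rfl⟩
    have := hφ.1
    positivity)
  have hα : 0 < 1 - α := by linarith
  have hw : ∀ s φ, 0 < s → φ ∈ Set.Ioo 0 (π / m) → |w s φ| ≤ M * φ ^ (-α) := by
    intro s φ hs hφ
    have hle : (s + φ) ^ α * |w s φ| ≤ M := le_csSup hbdd ⟨s, φ, hs, hφ, rfl⟩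
    have hφα : 0 < φ ^ α := rpow_pos_of_pos hφ.1 α
    rw [rpow_neg hφ.1.le, ← div_eq_mul_inv, le_div_iff₀ hφα, mul_comm]
    refine le_trans ?_ hle
    gcongr
    · exact hφ.1.le
    · linarith
  let g : ℝ → ℝ → ENNReal := fun s φ =>
    ENNReal.ofReal (radialKernel m (s / r) (m * (φ - θ))) * ENNReal.ofReal (M * φ ^ (-α))
  have hg : Measurable (Function.uncurry g) := by
    unfold g radialKernel
    fun_prop
  have hbound : ∫⁻ s in Set.Ioi (0 : ℝ), ∫⁻ φ in Set.Ioo (0 : ℝ) (π / m), g s φ ≤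
      ENNReal.ofReal (9 * π * r * (M * (2 / (1 - α)))) := by
    rw [lintegral_lintegral_swap hg.aemeasurable]
    calc ∫⁻ φ in Set.Ioo (0 : ℝ) (π / m), ∫⁻ s in Set.Ioi (0 : ℝ), g s φ
        ≤ ∫⁻ φ in Set.Ioo (0 : ℝ) (π / m),
            ENNReal.ofReal (9 * π * r) * (ENNReal.ofReal M * ENNReal.ofReal (φ ^ (-α))) := by
          refine lintegral_mono fun φ => ?_
          rw [lintegral_mul_const' _ _ ENNReal.ofReal_ne_top, ENNReal.ofReal_mul hM0]
          gcongr
          exact lintegral_radialKernel_le hm hr _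
      _ ≤ ENNReal.ofReal (9 * π * r) * (ENNReal.ofReal M * ENNReal.ofReal (2 / (1 - α))) := by
          rw [lintegral_const_mul' _ _ ENNReal.ofReal_ne_top,
            lintegral_const_mul' _ _ ENNReal.ofReal_ne_top]
          gcongr
          refine lintegral_rpow_neg_le (by positivity) ?_ h0 h1
          rw [div_le_iff₀ (by linarith)]
          linarith [pi_le_four]
      _ = _ := by
          rw [← ENNReal.ofReal_mul hM0, ← ENNReal.ofReal_mul (by positivity)]
  have hInt : |∫ s in Set.Ioi (0 : ℝ), ∫ φ in Set.Ioo (0 : ℝ) (π / m),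
      Real.sin ((m : ℝ) * (φ - θ)) * w s φ * (s / r) ^ (-(m : ℤ)) /
        (1 - 2 * (s / r) ^ (-(m : ℤ)) * Real.cos ((m : ℝ) * (φ - θ)) +
          (s / r) ^ (-(2 * m : ℤ))) * (s / r)| ≤ 9 * π * r * (M * (2 / (1 - α))) := by
    rw [← ENNReal.ofReal_le_ofReal_iff (by positivity), ← Real.enorm_eq_ofReal_abs]
    refine le_trans (enorm_integral_le_lintegral_enorm _) (le_trans ?_ hbound)
    refine setLIntegral_mono' measurableSet_Ioi fun s hs => ?_
    refine le_trans (enorm_integral_le_lintegral_enorm _) ?_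
    refine setLIntegral_mono' measurableSet_Ioo fun φ hφ => ?_
    have ht : 0 < s / r := div_pos hs hr
    have hK := radialKernel_nonneg m ht.le (m * (φ - θ))
    rw [Real.enorm_eq_ofReal_abs, abs_integrand_eq m ht, ENNReal.ofReal_mul hK]
    unfold g
    gcongr
    exact hw s φ hs hφ
  rw [ur, abs_mul, abs_of_nonneg (by positivity)]
  calc (m : ℝ) ^ 2 / (2 * π) * _ ≤ m ^ 2 / (2 * π) * (9 * π * r * (M * (2 / (1 - α)))) :=
        mul_le_mul_of_nonneg_left hInt (by positivity)
    _ = 9 * m ^ 2 / (1 - α) * r * M := by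
        field_simp
end

section
/- There exists a constant C > 0 depending only on m such that for every α ∈ [0,1), every admissible ω, and all r > 0 and θ ∈ (0, π/m), one has |u^θ(r,θ)| ≤ (C/(1−α)²) · r · ‖(s+φ)^α w‖_∞. (Lemma 4.1, angular component: the velocity field generated by such vorticity vanishes at least linearly at the origin.) -/
open Real MeasureTheory

lemma abs_sub_cos_div_le {q δ ε : ℝ} (hq0 : 0 ≤ q) (hq1 : q < 1) (hε0 : 0 ≤ ε) (hε1 : ε ≤ 1)
    (hδ : Real.sin (δ / 2) ≠ 0) :
    |q - Real.cos δ| / (1 - 2 * q * Real.cos δ + q ^ 2) ≤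
      (1 - q) ^ (ε - 1) * |Real.sin (δ / 2)| ^ (-ε) := by
  set S := |Real.sin (δ / 2)| with hS
  have hS0 : 0 < S := abs_pos.mpr hδ
  have hS2 : S ^ 2 = Real.sin (δ / 2) ^ 2 := sq_abs _
  have hS1 : S ^ 2 ≤ 1 := by rw [hS2]; exact Real.sin_sq_le_one _
  have hcos : Real.cos δ = 1 - 2 * S ^ 2 := by
    rw [hS2]
    have h := Real.cos_two_mul (δ / 2)
    rw [mul_div_cancel₀ δ two_ne_zero] at h
    rw [h, Real.cos_sq']; ring
  set D := 1 - 2 * q * Real.cos δ + q ^ 2 with hD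
  have hDq : (1 - q) ^ 2 ≤ D := by rw [hD, hcos]; nlinarith [mul_nonneg hq0 (sq_nonneg S)]
  have hDS : S ^ 2 ≤ D := by
    rw [hD, hcos]
    nlinarith [mul_nonneg hq0 (sq_nonneg S), mul_nonneg (sub_nonneg.mpr hS1) (sq_nonneg (1 - q)),
      mul_nonneg (sq_nonneg S) (sq_nonneg q)]
  have hDc : (q - Real.cos δ) ^ 2 ≤ D := by
    rw [hD]; nlinarith [Real.cos_sq_le_one δ]
  have h1q : 0 < 1 - q := by linarith
  have hD0 : 0 < D := lt_of_lt_of_le (by positivity) hDq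
  set R := √D with hR
  have hR0 : 0 < R := Real.sqrt_pos.mpr hD0
  have hRD : D = R * R := (Real.mul_self_sqrt hD0.le).symm
  have hRq : 1 - q ≤ R := Real.le_sqrt_of_sq_le hDq
  have hRS : S ≤ R := Real.le_sqrt_of_sq_le hDS
  have hRc : |q - Real.cos δ| ≤ R := Real.abs_le_sqrt hDc
  calc |q - Real.cos δ| / D ≤ R / (R * R) := by rw [hRD]; gcongr
    _ = R ^ (ε - 1) * R ^ (-ε) := by
      rw [← Real.rpow_add hR0, show ε - 1 + -ε = (-1 : ℝ) by ring, Real.rpow_neg_one]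
      field_simp
    _ ≤ (1 - q) ^ (ε - 1) * S ^ (-ε) := by
      gcongr ?_ * ?_
      · exact Real.rpow_le_rpow_of_nonpos h1q hRq (by linarith)
      · exact Real.rpow_le_rpow_of_nonpos hS0 hRS (by linarith)

lemma rpow_neg_mul_rpow_neg_le {a b α ε : ℝ} (ha : 0 < a) (hb : 0 < b) (hα : 0 ≤ α)
    (hε : 0 ≤ ε) : a ^ (-α) * b ^ (-ε) ≤ a ^ (-(α + ε)) + b ^ (-(α + ε)) := by
  rcases le_total a b with h | h
  · calc a ^ (-α) * b ^ (-ε) ≤ a ^ (-α) * a ^ (-ε) := by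
          gcongr ?_ * ?_
          exact Real.rpow_le_rpow_of_nonpos ha h (by linarith)
      _ = a ^ (-(α + ε)) := by rw [← Real.rpow_add ha]; congr 1; ring
      _ ≤ _ := le_add_of_nonneg_right (by positivity)
  · calc a ^ (-α) * b ^ (-ε) ≤ b ^ (-α) * b ^ (-ε) := by
          gcongr ?_ * ?_
          exact Real.rpow_le_rpow_of_nonpos hb h (by linarith)
      _ = b ^ (-(α + ε)) := by rw [← Real.rpow_add hb]; congr 1; ring
      _ ≤ _ := le_add_of_nonneg_left (by positivity)

lemma abs_div_pi_le_abs_sin_half_or {δ : ℝ} (h1 : -(2 * π) ≤ δ) (h2 : δ ≤ π) :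
    |δ| / π ≤ |Real.sin (δ / 2)| ∨ |δ + 2 * π| / π ≤ |Real.sin (δ / 2)| := by
  have hπ := Real.pi_pos
  rcases le_total (-π) δ with h | h
  · left
    have := Real.mul_abs_le_abs_sin (x := δ / 2) (by rw [abs_le]; constructor <;> linarith)
    rw [abs_div, abs_two] at this
    calc |δ| / π = 2 / π * (|δ| / 2) := by ring
      _ ≤ _ := this
  · right
    have := Real.mul_abs_le_abs_sin (x := δ / 2 + π) (by rw [abs_le]; constructor <;> linarith)
    rw [Real.sin_add_pi, abs_neg] at this
    calc |δ + 2 * π| / π = 2 / π * |δ / 2 + π| := by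
          rw [show δ + 2 * π = 2 * (δ / 2 + π) by ring, abs_mul, abs_two]; ring
      _ ≤ _ := this

lemma abs_sin_rpow_neg_le {M θ φ γ : ℝ} (hM : 3 ≤ M) (hθ : θ ∈ Set.Ioo 0 (π / M))
    (hφ : φ ∈ Set.Ioo (-(π / M)) (π / M)) (hne : φ ≠ θ) (hγ0 : 0 ≤ γ) (hγ1 : γ ≤ 1) :
    |Real.sin (M * (φ - θ) / 2)| ^ (-γ) ≤
      2 * |φ - θ| ^ (-γ) + 2 * |φ - (θ - 2 * π / M)| ^ (-γ) := by
  have hπ := Real.pi_pos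
  have hM0 : 0 < M := by linarith
  have hMπ : M * (π / M) = π := by field_simp
  obtain ⟨hθ1, hθ2⟩ := hθ
  obtain ⟨hφ1, hφ2⟩ := hφ
  have hc : (M / π) ^ (-γ) ≤ 2 := by
    rw [Real.rpow_neg (by positivity), ← Real.inv_rpow (by positivity), inv_div]
    have h2 : π / M ≤ 2 := by
      rw [div_le_iff₀ hM0]; linarith [Real.pi_le_four]
    calc (π / M) ^ γ ≤ 2 ^ γ := by gcongr
      _ ≤ 2 ^ (1 : ℝ) := Real.rpow_le_rpow_of_exponent_le (by norm_num) hγ1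
      _ = 2 := Real.rpow_one 2
  have key : ∀ t S : ℝ, t ≠ 0 → M / π * |t| ≤ S → S ^ (-γ) ≤ 2 * |t| ^ (-γ) := by
    intro t S ht h
    have ht' := abs_pos.mpr ht
    calc S ^ (-γ) ≤ (M / π * |t|) ^ (-γ) :=
          Real.rpow_le_rpow_of_nonpos (by positivity) h (by linarith)
      _ = (M / π) ^ (-γ) * |t| ^ (-γ) := Real.mul_rpow (by positivity) (abs_nonneg _)
      _ ≤ _ := by gcongr
  have hp : ∀ t : ℝ, 0 ≤ 2 * |t| ^ (-γ) := fun t => by positivity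
  have hpos : 0 < φ - (θ - 2 * π / M) := by
    have : 2 * π / M = π / M + π / M := by ring
    linarith
  rcases abs_div_pi_le_abs_sin_half_or (δ := M * (φ - θ)) (by nlinarith) (by nlinarith) with h | h
  · refine (key (φ - θ) _ (sub_ne_zero.mpr hne) ?_).trans (le_add_of_nonneg_right (hp _))
    rw [abs_mul, abs_of_pos hM0] at h
    calc _ = M * |φ - θ| / π := by ring
      _ ≤ _ := h
  · refine (key (φ - (θ - 2 * π / M)) _ hpos.ne' ?_).trans (le_add_of_nonneg_left (hp _))
    have e : M * (φ - θ) + 2 * π = M * (φ - (θ - 2 * π / M)) := by field_simp; ring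
    rw [e, abs_mul, abs_of_pos hM0] at h
    calc _ = M * |φ - (θ - 2 * π / M)| / π := by ring
      _ ≤ _ := h

lemma integrableOn_abs_rpow_neg {γ L : ℝ} (hγ : γ < 1) (hL : 0 ≤ L) :
    IntegrableOn (fun t : ℝ => |t| ^ (-γ)) (Set.Ioc (-L) L) ∧
      ∫ t in Set.Ioc (-L) L, |t| ^ (-γ) = 2 * (L ^ (1 - γ) / (1 - γ)) := by
  have hpos : IntegrableOn (fun t : ℝ => |t| ^ (-γ)) (Set.Ioc 0 L) := by
    have h := (intervalIntegral.intervalIntegrable_rpow' (a := 0) (b := L) (r := -γ)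
      (by linarith)).1
    refine h.congr_fun (fun t ht => ?_) measurableSet_Ioc
    simp only [abs_of_pos ht.1]
  have hI : IntervalIntegrable (fun t : ℝ => |t| ^ (-γ)) volume 0 L :=
    (intervalIntegrable_iff_integrableOn_Ioc_of_le hL).mpr hpos
  have hI' : IntervalIntegrable (fun t : ℝ => |t| ^ (-γ)) volume (-L) 0 := by
    have := hI.comp_sub_left 0
    simp only [zero_sub, sub_zero, abs_neg] at this
    exact this.symm
  have hval : ∫ t in (0 : ℝ)..L, |t| ^ (-γ) = L ^ (1 - γ) / (1 - γ) := by
    have : ∫ t in (0 : ℝ)..L, |t| ^ (-γ) = ∫ t in (0 : ℝ)..L, t ^ (-γ) := by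
      refine intervalIntegral.integral_congr fun t ht => ?_
      rw [Set.uIcc_of_le hL] at ht
      simp only [abs_of_nonneg ht.1]
    rw [this, integral_rpow (Or.inl (by linarith)), Real.zero_rpow (by linarith)]
    rw [show -γ + 1 = 1 - γ by ring, sub_zero]
  have hval' : ∫ t in (-L)..0, |t| ^ (-γ) = L ^ (1 - γ) / (1 - γ) := by
    have := intervalIntegral.integral_comp_neg (a := 0) (b := L) (fun t : ℝ => |t| ^ (-γ))
    simp only [abs_neg, neg_zero] at this
    rw [← this, hval]
  refine ⟨(intervalIntegrable_iff_integrableOn_Ioc_of_le (by linarith)).mp (hI'.trans hI), ?_⟩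
  rw [← intervalIntegral.integral_of_le (by linarith),
    ← intervalIntegral.integral_add_adjacent_intervals hI' hI, hval, hval']
  ring

lemma integral_abs_sub_rpow_neg_le {γ c a b : ℝ} (hγ0 : 0 ≤ γ) (hγ : γ < 1)
    (ha : c - 4 ≤ a) (hb : b ≤ c + 4) :
    IntegrableOn (fun t : ℝ => |t - c| ^ (-γ)) (Set.Ioo a b) ∧
      ∫ t in Set.Ioo a b, |t - c| ^ (-γ) ≤ 8 / (1 - γ) := by
  obtain ⟨hi, hv⟩ := integrableOn_abs_rpow_neg hγ (L := 4) (by norm_num)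
  have hsub : Set.Ioo a b ⊆ Set.Ioc (c - 4) (c + 4) :=
    fun t ht => ⟨by linarith [ht.1], by linarith [ht.2]⟩
  have hi' : IntegrableOn (fun t : ℝ => |t - c| ^ (-γ)) (Set.Ioc (c - 4) (c + 4)) := by
    have := ((intervalIntegrable_iff_integrableOn_Ioc_of_le (by norm_num)).mpr hi).comp_sub_right c
    rw [intervalIntegrable_iff_integrableOn_Ioc_of_le (by linarith)] at this
    convert this using 2
    all_goals first | rfl | ring
  refine ⟨hi'.mono_set hsub, ?_⟩
  have hv' : ∫ t in Set.Ioc (c - 4) (c + 4), |t - c| ^ (-γ) =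
      2 * (4 ^ (1 - γ) / (1 - γ)) := by
    rw [← hv, ← intervalIntegral.integral_of_le (by linarith),
      ← intervalIntegral.integral_of_le (by linarith),
      intervalIntegral.integral_comp_sub_right (fun t => |t| ^ (-γ)) c]
    congr 1 <;> ring
  have h4 : (4 : ℝ) ^ (1 - γ) ≤ 4 := by
    calc (4 : ℝ) ^ (1 - γ) ≤ 4 ^ (1 : ℝ) :=
          Real.rpow_le_rpow_of_exponent_le (by norm_num) (by linarith)
      _ = 4 := Real.rpow_one 4
  have h1 : 0 < 1 - γ := by linarith
  calc _ ≤ ∫ t in Set.Ioc (c - 4) (c + 4), |t - c| ^ (-γ) :=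
        setIntegral_mono_set hi' (Filter.Eventually.of_forall fun t => by positivity)
          hsub.eventuallyLE
    _ = 2 * (4 ^ (1 - γ) / (1 - γ)) := hv'
    _ ≤ 2 * (4 / (1 - γ)) := by gcongr
    _ = 8 / (1 - γ) := by ring

lemma abs_integral_angular_le {M α θ N A : ℝ} {f F : ℝ → ℝ} (hM : 3 ≤ M) (hα0 : 0 ≤ α)
    (hα1 : α < 1) (hθ : θ ∈ Set.Ioo 0 (π / M)) (hN : 0 ≤ N) (hA : 0 ≤ A)
    (hf : ∀ φ ∈ Set.Ioo (-(π / M)) (π / M), φ ≠ 0 → |f φ| ≤ N * |φ| ^ (-α))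
    (hF : ∀ φ, Real.sin (M * (φ - θ) / 2) ≠ 0 →
      |F φ| ≤ |f φ| * (A * |Real.sin (M * (φ - θ) / 2)| ^ (-((1 - α) / 2)))) :
    |∫ φ in Set.Ioo (-(π / M)) (π / M), F φ| ≤ 80 * N / (1 - α) * A := by
  have hπ := Real.pi_pos
  have hM0 : 0 < M := by linarith
  have hMπ : M * (π / M) = π := by field_simp
  have h2π : 2 * π / M = π / M + π / M := by ring
  have hπM : π / M ≤ 4 / 3 := by
    rw [div_le_iff₀ hM0]; linarith [Real.pi_le_four]
  obtain ⟨hθ1, hθ2⟩ := hθ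
  set γ := (1 + α) / 2 with hγ
  have hγ0 : 0 ≤ γ := by rw [hγ]; linarith
  have hγ1 : γ < 1 := by rw [hγ]; linarith
  obtain ⟨i1, v1⟩ := integral_abs_sub_rpow_neg_le (c := 0) (a := -(π / M)) (b := π / M) hγ0 hγ1
    (by linarith) (by linarith)
  obtain ⟨i2, v2⟩ := integral_abs_sub_rpow_neg_le (c := θ) (a := -(π / M)) (b := π / M) hγ0 hγ1
    (by linarith) (by linarith)
  obtain ⟨i3, v3⟩ := integral_abs_sub_rpow_neg_le (c := θ - 2 * π / M) (a := -(π / M))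
    (b := π / M) hγ0 hγ1 (by linarith) (by linarith)
  set g : ℝ → ℝ := fun φ => N * A * (|φ - 0| ^ (-γ) +
    (2 * |φ - θ| ^ (-γ) + 2 * |φ - (θ - 2 * π / M)| ^ (-γ))) with hg
  have hgi : IntegrableOn g (Set.Ioo (-(π / M)) (π / M)) :=
    (i1.add ((i2.const_mul 2).add (i3.const_mul 2))).const_mul _
  have hne : ∀ c : ℝ, ∀ᵐ φ ∂(volume.restrict (Set.Ioo (-(π / M)) (π / M))), φ ≠ c := fun c =>
    ae_restrict_of_ae (Measure.ae_ne volume c)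
  have hbound : ∀ᵐ φ ∂(volume.restrict (Set.Ioo (-(π / M)) (π / M))), ‖F φ‖ ≤ g φ := by
    filter_upwards [hne 0, hne θ, ae_restrict_mem measurableSet_Ioo] with φ h0 hφθ hφ
    have hsin : Real.sin (M * (φ - θ) / 2) ≠ 0 := by
      obtain ⟨hφ1, hφ2⟩ := hφ
      rcases lt_or_gt_of_ne hφθ with h | h
      · exact (Real.sin_neg_of_neg_of_neg_pi_lt (by nlinarith) (by nlinarith)).ne
      · exact (Real.sin_pos_of_pos_of_lt_pi (by nlinarith) (by nlinarith)).ne'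
    have hexp : α + (1 - α) / 2 = γ := by rw [hγ]; ring
    rw [Real.norm_eq_abs]
    calc |F φ| ≤ |f φ| * (A * |Real.sin (M * (φ - θ) / 2)| ^ (-((1 - α) / 2))) := hF φ hsin
      _ ≤ N * |φ| ^ (-α) * (A * |Real.sin (M * (φ - θ) / 2)| ^ (-((1 - α) / 2))) := by
        gcongr
        exact hf φ hφ h0
      _ = N * A * (|φ| ^ (-α) * |Real.sin (M * (φ - θ) / 2)| ^ (-((1 - α) / 2))) := by ring
      _ ≤ N * A * (|φ| ^ (-γ) + |Real.sin (M * (φ - θ) / 2)| ^ (-γ)) := by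
        rw [← hexp]
        gcongr
        exact rpow_neg_mul_rpow_neg_le (abs_pos.mpr h0) (abs_pos.mpr hsin) hα0 (by linarith)
      _ ≤ g φ := by
        rw [hg]
        simp only [sub_zero]
        gcongr
        exact abs_sin_rpow_neg_le hM ⟨hθ1, hθ2⟩ hφ hφθ hγ0 hγ1.le
  have h1α : 1 - γ = (1 - α) / 2 := by rw [hγ]; ring
  rw [← Real.norm_eq_abs]
  calc _ ≤ ∫ φ in Set.Ioo (-(π / M)) (π / M), g φ := norm_integral_le_of_norm_le hgi hbound
    _ = N * A * ((∫ φ in Set.Ioo (-(π / M)) (π / M), |φ - 0| ^ (-γ)) +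
        (2 * (∫ φ in Set.Ioo (-(π / M)) (π / M), |φ - θ| ^ (-γ)) +
          2 * ∫ φ in Set.Ioo (-(π / M)) (π / M), |φ - (θ - 2 * π / M)| ^ (-γ))) := by
      have i23 : IntegrableOn (fun φ => 2 * |φ - θ| ^ (-γ) + 2 * |φ - (θ - 2 * π / M)| ^ (-γ))
          (Set.Ioo (-(π / M)) (π / M)) := (i2.const_mul 2).add (i3.const_mul 2)
      rw [hg, integral_const_mul, integral_add i1 i23,
        integral_add (i2.const_mul 2) (i3.const_mul 2), integral_const_mul, integral_const_mul]
    _ ≤ N * A * (8 / (1 - γ) + (2 * (8 / (1 - γ)) + 2 * (8 / (1 - γ)))) := by gcongr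
    _ = 80 * N / (1 - α) * A := by
      rw [h1α]
      have : 1 - α ≠ 0 := by linarith
      field_simp
      ring

lemma integral_inner_radial {r ε : ℝ} (hr : 0 < r) (hε : 0 < ε) :
    IntegrableOn (fun s : ℝ => (1 - s / r) ^ (ε - 1)) (Set.Ioo 0 r) ∧
      ∫ s in Set.Ioo 0 r, (1 - s / r) ^ (ε - 1) = r / ε := by
  have hpos : ∀ s ∈ Set.Ioo 0 r, 0 < 1 - s / r := fun s hs => by
    rw [sub_pos, div_lt_one hr]; exact hs.2
  have hcont : ContinuousOn (fun s : ℝ => -(r / ε) * (1 - s / r) ^ ε) (Set.Icc 0 r) := by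
    refine ContinuousOn.mul continuousOn_const (ContinuousOn.rpow_const (by fun_prop) ?_)
    exact fun _ _ => Or.inr hε.le
  have hderiv : ∀ s ∈ Set.Ioo 0 r,
      HasDerivAt (fun s : ℝ => -(r / ε) * (1 - s / r) ^ ε) ((1 - s / r) ^ (ε - 1)) s := by
    intro s hs
    have h := ((((hasDerivAt_id s).div_const r).const_sub 1).rpow_const (p := ε)
      (Or.inl (hpos s hs).ne')).const_mul (-(r / ε))
    refine h.congr_deriv ?_
    simp only [id]
    field_simp
  have hi := intervalIntegral.integrableOn_deriv_of_nonneg hcont hderiv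
    (fun s hs => (Real.rpow_pos_of_pos (hpos s hs) _).le)
  refine ⟨hi.mono_set Set.Ioo_subset_Ioc_self, ?_⟩
  rw [← integral_Ioc_eq_integral_Ioo, ← intervalIntegral.integral_of_le hr.le,
    intervalIntegral.integral_eq_sub_of_hasDerivAt_of_le hr.le hcont hderiv
      ((intervalIntegrable_iff_integrableOn_Ioc_of_le hr.le).mpr hi)]
  simp [div_self hr.ne', Real.zero_rpow hε.ne']

lemma integral_outer_radial {r ε : ℝ} (hr : 0 < r) (hε : 0 < ε) :
    IntegrableOn (fun s : ℝ => (1 - r / s) ^ (ε - 1) * (r / s) ^ 2) (Set.Ioi r) ∧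
      ∫ s in Set.Ioi r, (1 - r / s) ^ (ε - 1) * (r / s) ^ 2 = r / ε := by
  have hpos : ∀ s ∈ Set.Ioi r, 0 < 1 - r / s := fun s hs => by
    rw [sub_pos, div_lt_one (hr.trans hs)]; exact hs
  have hcont : ContinuousWithinAt (fun s : ℝ => r / ε * (1 - r / s) ^ ε) (Set.Ici r) r := by
    refine ContinuousAt.continuousWithinAt (ContinuousAt.mul continuousAt_const
      (ContinuousAt.rpow_const ?_ (Or.inr hε.le)))
    exact continuousAt_const.sub (continuousAt_const.div continuousAt_id hr.ne')
  have hderiv : ∀ s ∈ Set.Ioi r, HasDerivAt (fun s : ℝ => r / ε * (1 - r / s) ^ ε)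
      ((1 - r / s) ^ (ε - 1) * (r / s) ^ 2) s := by
    intro s hs
    have hs0 : s ≠ 0 := (hr.trans hs).ne'
    have h := (((((hasDerivAt_id s).inv hs0).const_mul r).const_sub 1).rpow_const (p := ε)
      (Or.inl (by simpa [div_eq_mul_inv] using (hpos s hs).ne'))).const_mul (r / ε)
    refine HasDerivAt.congr_deriv (f' := _) h ?_
    simp only [id, Pi.inv_apply, ← div_eq_mul_inv]
    field_simp
  have hlim : Filter.Tendsto (fun s : ℝ => r / ε * (1 - r / s) ^ ε) Filter.atTop
      (nhds (r / ε * (1 - 0) ^ ε)) := by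
    refine Filter.Tendsto.const_mul _ (Filter.Tendsto.rpow_const ?_ (Or.inr hε.le))
    exact tendsto_const_nhds.sub (tendsto_const_nhds.div_atTop Filter.tendsto_id)
  have hnn : ∀ s ∈ Set.Ioi r, 0 ≤ (1 - r / s) ^ (ε - 1) * (r / s) ^ 2 := fun s hs =>
    mul_nonneg (Real.rpow_nonneg (hpos s hs).le _) (sq_nonneg _)
  refine ⟨integrableOn_Ioi_deriv_of_nonneg hcont hderiv hnn hlim, ?_⟩
  rw [integral_Ioi_of_hasDerivAt_of_nonneg hcont hderiv hnn hlim]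
  simp [div_self hr.ne', Real.zero_rpow hε.ne']

lemma abs_uthetaOuter_le {m : ℕ} (hm : 3 ≤ m) {w : ℝ → ℝ → ℝ} {α N r θ : ℝ} (hα0 : 0 ≤ α)
    (hα1 : α < 1) (hN : 0 ≤ N) (hr : 0 < r) (hθ : θ ∈ Set.Ioo 0 (π / m))
    (hw : ∀ s, 0 < s → ∀ φ ∈ Set.Ioo (-(π / m)) (π / m), φ ≠ 0 → |w s φ| ≤ N * |φ| ^ (-α)) :
    |uthetaOuter m w r θ| ≤ m ^ 2 / (2 * π) * (160 * N * r / (1 - α) ^ 2) := by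
  have hπ := Real.pi_pos
  have hm' : (3 : ℝ) ≤ m := by exact_mod_cast hm
  set ε := (1 - α) / 2 with hε
  have hε0 : 0 < ε := by rw [hε]; linarith
  obtain ⟨hi, hv⟩ := integral_outer_radial hr hε0
  rw [uthetaOuter, abs_mul, abs_of_nonneg (by positivity)]
  gcongr
  rw [← Real.norm_eq_abs]
  refine (norm_integral_le_of_norm_le (hi.const_mul (80 * N / (1 - α))) ?_).trans_eq ?_
  · filter_upwards [ae_restrict_mem measurableSet_Ioi] with s hs
    have hs0 : 0 < s := hr.trans hs
    have hy0 : 0 < r / s := by positivity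
    have hy1 : r / s < 1 := (div_lt_one hs0).mpr hs
    have hx : (s / r) ^ (-(m : ℤ)) = (r / s) ^ m := by
      rw [zpow_neg, zpow_natCast, ← inv_pow, inv_div]
    have hx2 : (s / r) ^ (-(2 * m : ℤ)) = ((r / s) ^ m) ^ 2 := by
      rw [← hx, ← zpow_natCast, ← zpow_mul]; congr 1; push_cast; ring
    rw [Real.norm_eq_abs]
    refine abs_integral_angular_le (f := w s) hm' hα0 hα1 hθ hN
      (mul_nonneg (Real.rpow_nonneg (by linarith) _) (sq_nonneg _)) (hw s hs0) ?_
    intro φ hφ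
    simp only [hx, hx2]
    set q := (r / s) ^ m with hq
    have hq0 : 0 ≤ q := by positivity
    have hqy : q ≤ r / s := pow_le_of_le_one hy0.le hy1.le (by omega)
    have hk := abs_sub_cos_div_le (δ := m * (φ - θ)) hq0 (hqy.trans_lt hy1) hε0.le
      (by rw [hε]; linarith) hφ
    have hqx : q * (s / r) ≤ (r / s) ^ 2 := by
      have : q ≤ (r / s) ^ 3 := pow_le_pow_of_le_one hy0.le hy1.le hm
      calc q * (s / r) ≤ (r / s) ^ 3 * (s / r) := by gcongr
        _ = (r / s) ^ 2 := by field_simp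
    have hD : 0 ≤ 1 - 2 * q * Real.cos (m * (φ - θ)) + q ^ 2 := by
      nlinarith [Real.cos_sq_le_one (m * (φ - θ)), sq_nonneg (q - Real.cos (m * (φ - θ)))]
    have hmono : (1 - q) ^ (ε - 1) ≤ (1 - r / s) ^ (ε - 1) :=
      Real.rpow_le_rpow_of_nonpos (by linarith) (by linarith) (by rw [hε]; linarith)
    have h1q : 0 ≤ (1 - q) ^ (ε - 1) := Real.rpow_nonneg (by linarith) _
    rw [abs_mul, abs_mul, abs_div, abs_mul, abs_of_nonneg hD, abs_of_nonneg hq0,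
      abs_of_pos (div_pos hs0 hr)]
    calc _ = |w s φ| * (|q - Real.cos (m * (φ - θ))| /
          (1 - 2 * q * Real.cos (m * (φ - θ)) + q ^ 2) * (q * (s / r))) := by ring
      _ ≤ |w s φ| * ((1 - q) ^ (ε - 1) * |Real.sin (m * (φ - θ) / 2)| ^ (-ε) *
          (r / s) ^ 2) := by gcongr
      _ ≤ |w s φ| * ((1 - r / s) ^ (ε - 1) * |Real.sin (m * (φ - θ) / 2)| ^ (-ε) *
          (r / s) ^ 2) := by gcongr
      _ = _ := by ring
  · rw [integral_const_mul, hv, hε]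
    have : 1 - α ≠ 0 := by linarith
    field_simp
    ring

lemma abs_uthetaInner_le {m : ℕ} (hm : 3 ≤ m) {w : ℝ → ℝ → ℝ} {α N r θ : ℝ} (hα0 : 0 ≤ α)
    (hα1 : α < 1) (hN : 0 ≤ N) (hr : 0 < r) (hθ : θ ∈ Set.Ioo 0 (π / m))
    (hw : ∀ s, 0 < s → ∀ φ ∈ Set.Ioo (-(π / m)) (π / m), φ ≠ 0 → |w s φ| ≤ N * |φ| ^ (-α)) :
    |uthetaInner m w r θ| ≤ m ^ 2 / (2 * π) * (160 * N * r / (1 - α) ^ 2) := by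
  have hπ := Real.pi_pos
  have hm' : (3 : ℝ) ≤ m := by exact_mod_cast hm
  set ε := (1 - α) / 2 with hε
  have hε0 : 0 < ε := by rw [hε]; linarith
  obtain ⟨hi, hv⟩ := integral_inner_radial hr hε0
  rw [uthetaInner, abs_mul, abs_of_nonneg (by positivity)]
  gcongr
  rw [← Real.norm_eq_abs]
  refine (norm_integral_le_of_norm_le (hi.const_mul (80 * N / (1 - α))) ?_).trans_eq ?_
  · filter_upwards [ae_restrict_mem measurableSet_Ioo] with s hs
    have hs0 : 0 < s := hs.1
    have hy0 : 0 < s / r := by positivity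
    have hy1 : s / r < 1 := (div_lt_one hr).mpr hs.2
    have hx2 : (s / r) ^ (2 * m : ℤ) = ((s / r) ^ m) ^ 2 := by
      rw [← pow_mul, ← zpow_natCast]; congr 1; push_cast; ring
    rw [Real.norm_eq_abs]
    refine abs_integral_angular_le (f := w s) hm' hα0 hα1 hθ hN
      (Real.rpow_nonneg (by linarith) _) (hw s hs0) ?_
    intro φ hφ
    simp only [zpow_natCast, hx2]
    set q := (s / r) ^ m with hq
    have hq0 : 0 ≤ q := by positivity
    have hqy : q ≤ s / r := pow_le_of_le_one hy0.le hy1.le (by omega)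
    have hk := abs_sub_cos_div_le (δ := m * (φ - θ)) hq0 (hqy.trans_lt hy1) hε0.le
      (by rw [hε]; linarith) hφ
    have hqx : q * (s / r) ≤ 1 := mul_le_one₀ (by linarith) hy0.le hy1.le
    have hD : 0 ≤ 1 - 2 * q * Real.cos (m * (φ - θ)) + q ^ 2 := by
      nlinarith [Real.cos_sq_le_one (m * (φ - θ)), sq_nonneg (q - Real.cos (m * (φ - θ)))]
    have hmono : (1 - q) ^ (ε - 1) ≤ (1 - s / r) ^ (ε - 1) :=
      Real.rpow_le_rpow_of_nonpos (by linarith) (by linarith) (by rw [hε]; linarith)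
    have h1q : 0 ≤ (1 - q) ^ (ε - 1) := Real.rpow_nonneg (by linarith) _
    rw [abs_mul, abs_mul, abs_div, abs_mul, abs_of_nonneg hD, abs_of_nonneg hq0,
      abs_of_pos hy0, abs_sub_comm]
    calc _ = |w s φ| * (|q - Real.cos (m * (φ - θ))| /
          (1 - 2 * q * Real.cos (m * (φ - θ)) + q ^ 2) * (q * (s / r))) := by ring
      _ ≤ |w s φ| * ((1 - q) ^ (ε - 1) * |Real.sin (m * (φ - θ) / 2)| ^ (-ε) * 1) := by gcongr
      _ ≤ |w s φ| * ((1 - s / r) ^ (ε - 1) * |Real.sin (m * (φ - θ) / 2)| ^ (-ε) * 1) := by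
        gcongr
      _ = _ := by ring
  · rw [integral_const_mul, hv, hε]
    have : 1 - α ≠ 0 := by linarith
    field_simp
    ring

lemma norm_polar_ge {s φ : ℝ} (hs : 0 ≤ s) :
    s ≤ 2 * ‖((s * Real.cos φ, s * Real.sin φ) : ℝ × ℝ)‖ := by
  have h1 := norm_fst_le ((s * Real.cos φ, s * Real.sin φ) : ℝ × ℝ)
  have h2 := norm_snd_le ((s * Real.cos φ, s * Real.sin φ) : ℝ × ℝ)
  simp only [norm_mul, Real.norm_eq_abs, abs_of_nonneg hs] at h1 h2
  have h3 : 1 ≤ |Real.cos φ| + |Real.sin φ| := by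
    nlinarith [Real.sin_sq_add_cos_sq φ, sq_abs (Real.cos φ), sq_abs (Real.sin φ),
      Real.abs_cos_le_one φ, Real.abs_sin_le_one φ, abs_nonneg (Real.cos φ),
      abs_nonneg (Real.sin φ)]
  nlinarith

lemma bddAbove_weighted_polarRep {m : ℕ} {α : ℝ} (hα0 : 0 ≤ α) (hα1 : α < 1)
    (ω : SchwartzMap (ℝ × ℝ) ℝ) :
    BddAbove {y : ℝ | ∃ s φ : ℝ, 0 < s ∧ φ ∈ Set.Ioo 0 (π / m) ∧
      y = (s + φ) ^ α * |polarRep ω s φ|} := by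
  obtain ⟨C0, h0⟩ := ω.decay 0 0
  obtain ⟨C1, h1⟩ := ω.decay 1 0
  refine ⟨(1 + π / m) * C0 + 2 * C1, ?_⟩
  rintro y ⟨s, φ, hs, ⟨hφ0, hφ1⟩, rfl⟩
  have h0 := h0.2 (s * Real.cos φ, s * Real.sin φ)
  have h1 := h1.2 (s * Real.cos φ, s * Real.sin φ)
  simp only [pow_zero, one_mul, pow_one, norm_iteratedFDeriv_zero, Real.norm_eq_abs] at h0 h1
  have hn := norm_polar_ge (φ := φ) hs.le
  have hle : (s + φ) ^ α ≤ 1 + (s + φ) := by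
    calc (s + φ) ^ α ≤ (1 + (s + φ)) ^ α :=
          Real.rpow_le_rpow (by linarith) (by linarith) hα0
      _ ≤ (1 + (s + φ)) ^ (1 : ℝ) :=
        Real.rpow_le_rpow_of_exponent_le (by linarith) hα1.le
      _ = _ := Real.rpow_one _
  set a := |ω (s * Real.cos φ, s * Real.sin φ)| with ha
  have ha0 : 0 ≤ a := abs_nonneg _
  set n := ‖((s * Real.cos φ, s * Real.sin φ) : ℝ × ℝ)‖
  calc (s + φ) ^ α * a ≤ ((1 + π / m) + 2 * n) * a := by
        gcongr
        linarith
    _ = (1 + π / m) * a + 2 * (n * a) := by ring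
    _ ≤ _ := by gcongr

lemma abs_polarRep_le {m : ℕ} {α : ℝ} (hα0 : 0 ≤ α) (hα1 : α < 1)
    {ω : SchwartzMap (ℝ × ℝ) ℝ} (hω : IsAdmissible m ω) {s : ℝ} (hs : 0 < s) {φ : ℝ}
    (hφ : φ ∈ Set.Ioo (-(π / m)) (π / m)) (hφ0 : φ ≠ 0) :
    |polarRep ω s φ| ≤ wnorm m α (polarRep ω) * |φ| ^ (-α) := by
  have habs : |polarRep ω s φ| = |polarRep ω s (|φ|)| := by
    rcases abs_choice φ with h | h
    · rw [h]
    · rw [h, hω.1, abs_neg]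
  have hpos := abs_pos.mpr hφ0
  have hsup : (s + |φ|) ^ α * |polarRep ω s (|φ|)| ≤ wnorm m α (polarRep ω) :=
    le_csSup (bddAbove_weighted_polarRep hα0 hα1 ω) ⟨s, |φ|, hs, ⟨hpos, abs_lt.mpr hφ⟩, rfl⟩
  rw [habs, Real.rpow_neg hpos.le, ← div_eq_mul_inv, le_div_iff₀ (by positivity), mul_comm]
  refine le_trans ?_ hsup
  gcongr
  linarith

lemma wnorm_nonneg (m : ℕ) (β : ℝ) (h : ℝ → ℝ → ℝ) : 0 ≤ wnorm m β h := by
  refine Real.sSup_nonneg ?_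
  rintro y ⟨s, φ, hs, ⟨hφ, -⟩, rfl⟩
  positivity

/-- **Lemma 4.1, angular component.** Linear vanishing of `u^θ` at the origin. -/
theorem utheta_linear_growth (m : ℕ) (hm : 3 ≤ m) :
    ∃ C : ℝ, 0 < C ∧ ∀ α : ℝ, 0 ≤ α → α < 1 →
      ∀ ω : SchwartzMap (ℝ × ℝ) ℝ, IsAdmissible m ω →
        ∀ r θ : ℝ, 0 < r → θ ∈ Set.Ioo 0 (π / m) →
          |utheta m (polarRep ⇑ω) r θ| ≤
            C / (1 - α) ^ 2 * r * wnorm m α (polarRep ⇑ω) := by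
  have hπ := Real.pi_pos
  have hm0 : (0 : ℝ) < m := by exact_mod_cast (by omega : 0 < m)
  refine ⟨m ^ 2 / (2 * π) * 320, by positivity, ?_⟩
  intro α hα0 hα1 ω hω r θ hr hθ
  have hN := wnorm_nonneg m α (polarRep ω)
  have hw : ∀ s, 0 < s → ∀ φ ∈ Set.Ioo (-(π / m)) (π / m), φ ≠ 0 →
      |polarRep ω s φ| ≤ wnorm m α (polarRep ω) * |φ| ^ (-α) :=
    fun s hs φ hφ h0 => abs_polarRep_le hα0 hα1 hω hs hφ h0
  have h1 := abs_uthetaOuter_le hm hα0 hα1 hN hr hθ hw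
  have h2 := abs_uthetaInner_le hm hα0 hα1 hN hr hθ hw
  calc |utheta m (polarRep ω) r θ| ≤ _ + _ := abs_add_le _ _
    _ ≤ _ + _ := add_le_add h1 h2
    _ = _ := by ring
end

section
/- Let L > 0, T > 0, and let G : [0,T] × [0,L] → ℝ be continuous such that for every t ∈ [0,T] the function G(t,·) is strictly concave on [0,L], satisfies G(t,0) = 0, and is strictly positive on (0,L). Let χ₁, χ₂ : [0,T] → (0,L) be differentiable with χᵢ'(t) = 2 G(t, χᵢ(t)) for all t and i = 1,2, and suppose 0 < χ₁(t) < χ₂(t) < L for all t ∈ [0,T]. Then the function t ↦ χ₁(t)/χ₂(t) is strictly increasing on [0,T]. (Lemma 3.1: ratios of characteristics of the 0-homogeneous Euler flow are strictly increasing.) -/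
open Real

/-- A strictly concave function vanishing at `0` has a strictly decreasing ratio `f x / x` on the
positive half-line, stated here in cross-multiplied form. -/
theorem StrictConcaveOn.mul_lt_mul_of_apply_zero {s : Set ℝ} {f : ℝ → ℝ}
    (hf : StrictConcaveOn ℝ s f) (hf0 : f 0 = 0) {x y : ℝ} (h0 : (0 : ℝ) ∈ s) (hy : y ∈ s)
    (hx : 0 < x) (hxy : x < y) : x * f y < f x * y := by
  have h := hf.slope_anti_adjacent h0 hy hx hxy
  rw [hf0, sub_zero, sub_zero, div_lt_div_iff₀ (sub_pos.2 hxy) hx] at h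
  linarith

/-- **Lemma 3.1.** Ratios of characteristics of the 0-homogeneous Euler flow are strictly
increasing: if `G(t,·)` is continuous, strictly concave, vanishes at `0` and is strictly
positive on `(0,L)`, and `χ₁ < χ₂` solve `χ' = 2G(t,χ)` inside `(0,L)`, then
`t ↦ χ₁(t)/χ₂(t)` is strictly increasing on `[0,T]`. -/
theorem characteristic_ratio_strictMono (L T : ℝ) (hL : 0 < L) (hT : 0 < T)
    (G : ℝ → ℝ → ℝ)
    (hGc : ContinuousOn (fun p : ℝ × ℝ => G p.1 p.2) (Set.Icc 0 T ×ˢ Set.Icc 0 L))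
    (hGconc : ∀ t ∈ Set.Icc (0 : ℝ) T, StrictConcaveOn ℝ (Set.Icc 0 L) (G t))
    (hG0 : ∀ t ∈ Set.Icc (0 : ℝ) T, G t 0 = 0)
    (hGpos : ∀ t ∈ Set.Icc (0 : ℝ) T, ∀ θ ∈ Set.Ioo (0 : ℝ) L, 0 < G t θ)
    (χ₁ χ₂ : ℝ → ℝ)
    (hχ₁ : ∀ t ∈ Set.Icc (0 : ℝ) T, HasDerivAt χ₁ (2 * G t (χ₁ t)) t)
    (hχ₂ : ∀ t ∈ Set.Icc (0 : ℝ) T, HasDerivAt χ₂ (2 * G t (χ₂ t)) t)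
    (hord : ∀ t ∈ Set.Icc (0 : ℝ) T, 0 < χ₁ t ∧ χ₁ t < χ₂ t ∧ χ₂ t < L) :
    StrictMonoOn (fun t => χ₁ t / χ₂ t) (Set.Icc 0 T) := by
  have hderiv : ∀ t ∈ Set.Icc (0 : ℝ) T, HasDerivAt (fun t => χ₁ t / χ₂ t)
      ((2 * G t (χ₁ t) * χ₂ t - χ₁ t * (2 * G t (χ₂ t))) / χ₂ t ^ 2) t := fun t ht =>
    (hχ₁ t ht).div (hχ₂ t ht) ((hord t ht).1.trans (hord t ht).2.1).ne'
  refine strictMonoOn_of_deriv_pos (convex_Icc 0 T)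
    (fun t ht => (hderiv t ht).continuousAt.continuousWithinAt) fun t ht => ?_
  have ht' := interior_subset ht
  obtain ⟨h₁, h₁₂, h₂⟩ := hord t ht'
  rw [(hderiv t ht').deriv]
  have hchord := (hGconc t ht').mul_lt_mul_of_apply_zero (hG0 t ht')
    (Set.left_mem_Icc.2 hL.le) ⟨(h₁.trans h₁₂).le, h₂.le⟩ h₁ h₁₂
  exact div_pos (by linarith) (pow_pos (h₁.trans h₁₂) 2)
end

section
/- Let L > 0, T > 0, 0 < α < 1, and let G : [0,T] × [0,L] → ℝ be continuous such that for every t the function G(t,·) is strictly concave on [0,L], satisfies G(t,0) = 0, and is strictly positive on (0,L). Let χ : [0,T] × (0,L) → (0,L) be such that for each θ ∈ (0,L), the map t ↦ χ(t,θ) is differentiable with ∂_t χ(t,θ) = 2 G(t, χ(t,θ)) and χ(0,θ) = θ, and suppose that for each θ₁ < θ₂ one has χ(t,θ₁) < χ(t,θ₂) for all t. Let g : [0,T] × (0,L) → ℝ satisfy g(t, χ(t,θ)) = θ^{−α} for all t ∈ [0,T] and θ ∈ (0,L). Then for every t ∈ [0,T] and every 0 < η₁ < η₂ < L that lie in the range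 of χ(t,·), one has g(t,η₂)/g(t,η₁) ≤ (η₂/η₁)^{−α}. (Corollary 3.2: the power-law ratio bound on the vorticity profile is propagated by the flow.) -/
open Real

/-- A concave function on `[0, L]` vanishing at `0` has `f x / x` antitone, here in
cross-multiplied form. -/
theorem ConcaveOn.mul_le_mul_of_map_zero {L : ℝ} {f : ℝ → ℝ}
    (hf : ConcaveOn ℝ (Set.Icc 0 L) f) (h0 : f 0 = 0) {x y : ℝ} (hx : 0 < x) (hxy : x < y)
    (hy : y ≤ L) : f y * x ≤ y * f x := by
  have hy0 : 0 < y := hx.trans hxy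
  have h := hf.2 (Set.left_mem_Icc.2 (hy0.le.trans hy)) (show y ∈ Set.Icc 0 L from ⟨hy0.le, hy⟩)
    (sub_nonneg.2 ((div_le_one hy0).2 hxy.le)) (div_nonneg hx.le hy0.le)
    (sub_add_cancel 1 (x / y))
  simp only [smul_eq_mul, h0, mul_zero, zero_add, div_mul_cancel₀ x hy0.ne'] at h
  have h' := mul_le_mul_of_nonneg_left h hy0.le
  have e : y * (x / y * f y) = f y * x := by field_simp
  rwa [e] at h'

/-- **Corollary 3.2.** The power-law ratio bound on the vorticity profile is propagated by
the flow: if `g(t, χ(t,θ)) = θ^{−α}` along the characteristics `χ` of the velocity `2G`,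
with `G(t,·)` strictly concave, vanishing at `0` and positive on `(0,L)`, then for points
`η₁ < η₂` in the range of `χ(t,·)` one has `g(t,η₂)/g(t,η₁) ≤ (η₂/η₁)^{−α}`. -/
theorem powerlaw_ratio_propagation (L T α : ℝ) (hL : 0 < L) (hT : 0 < T)
    (hα0 : 0 < α) (hα1 : α < 1) (G : ℝ → ℝ → ℝ)
    (hGc : ContinuousOn (fun p : ℝ × ℝ => G p.1 p.2) (Set.Icc 0 T ×ˢ Set.Icc 0 L))
    (hGconc : ∀ t ∈ Set.Icc (0 : ℝ) T, StrictConcaveOn ℝ (Set.Icc 0 L) (G t))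
    (hG0 : ∀ t ∈ Set.Icc (0 : ℝ) T, G t 0 = 0)
    (hGpos : ∀ t ∈ Set.Icc (0 : ℝ) T, ∀ θ ∈ Set.Ioo (0 : ℝ) L, 0 < G t θ)
    (χ : ℝ → ℝ → ℝ)
    (hmem : ∀ t ∈ Set.Icc (0 : ℝ) T, ∀ θ ∈ Set.Ioo (0 : ℝ) L, χ t θ ∈ Set.Ioo (0 : ℝ) L)
    (hflow : ∀ θ ∈ Set.Ioo (0 : ℝ) L, ∀ t ∈ Set.Icc (0 : ℝ) T,
      HasDerivAt (fun τ => χ τ θ) (2 * G t (χ t θ)) t)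
    (hinit : ∀ θ ∈ Set.Ioo (0 : ℝ) L, χ 0 θ = θ)
    (hmono : ∀ t ∈ Set.Icc (0 : ℝ) T, ∀ θ₁ ∈ Set.Ioo (0 : ℝ) L, ∀ θ₂ ∈ Set.Ioo (0 : ℝ) L,
      θ₁ < θ₂ → χ t θ₁ < χ t θ₂)
    (g : ℝ → ℝ → ℝ)
    (hg : ∀ t ∈ Set.Icc (0 : ℝ) T, ∀ θ ∈ Set.Ioo (0 : ℝ) L, g t (χ t θ) = θ ^ (-α)) :
    ∀ t ∈ Set.Icc (0 : ℝ) T, ∀ η₁ η₂ : ℝ, 0 < η₁ → η₁ < η₂ → η₂ < L →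
      (∃ θ₁ ∈ Set.Ioo (0 : ℝ) L, χ t θ₁ = η₁) →
      (∃ θ₂ ∈ Set.Ioo (0 : ℝ) L, χ t θ₂ = η₂) →
      g t η₂ / g t η₁ ≤ (η₂ / η₁) ^ (-α) := by
  rintro t ht η₁ η₂ - hlt - ⟨θ₁, hθ₁, rfl⟩ ⟨θ₂, hθ₂, rfl⟩
  have hθ : θ₁ < θ₂ := by
    by_contra! h
    rcases h.eq_or_lt with rfl | h
    · exact lt_irrefl _ hlt
    · exact lt_asymm hlt (hmono t ht θ₂ hθ₂ θ₁ hθ₁ h)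
  have hd : ∀ s ∈ Set.Icc (0 : ℝ) T, HasDerivAt (fun τ => χ τ θ₂ / χ τ θ₁)
      ((2 * G s (χ s θ₂) * χ s θ₁ - χ s θ₂ * (2 * G s (χ s θ₁))) / χ s θ₁ ^ 2) s :=
    fun s hs => (hflow θ₂ hθ₂ s hs).div (hflow θ₁ hθ₁ s hs) (hmem s hs θ₁ hθ₁).1.ne'
  have hanti : AntitoneOn (fun τ => χ τ θ₂ / χ τ θ₁) (Set.Icc 0 T) := by
    refine antitoneOn_of_deriv_nonpos (convex_Icc 0 T)
      (fun s hs => (hd s hs).continuousAt.continuousWithinAt)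
      (fun s hs => (hd s (interior_subset hs)).differentiableAt.differentiableWithinAt) ?_
    intro s hs
    replace hs := interior_subset hs
    rw [(hd s hs).deriv]
    refine div_nonpos_of_nonpos_of_nonneg ?_ (sq_nonneg _)
    have := (hGconc s hs).concaveOn.mul_le_mul_of_map_zero (hG0 s hs) (hmem s hs θ₁ hθ₁).1
      (hmono s hs θ₁ hθ₁ θ₂ hθ₂ hθ) (hmem s hs θ₂ hθ₂).2.le
    linarith
  have hratio : χ t θ₂ / χ t θ₁ ≤ θ₂ / θ₁ := by
    simpa only [hinit θ₁ hθ₁, hinit θ₂ hθ₂] using hanti ⟨le_rfl, hT.le⟩ ht ht.1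
  rw [hg t ht θ₁ hθ₁, hg t ht θ₂ hθ₂, ← Real.div_rpow hθ₂.1.le hθ₁.1.le]
  exact Real.rpow_le_rpow_of_nonpos (div_pos (hmem t ht θ₂ hθ₂).1 (hmem t ht θ₁ hθ₁).1)
    hratio (neg_nonpos.2 hα0.le)
end

section
/- Let m ≥ 3 be an integer, set L = π/m, and let 0 < α < 1. There exists a constant c > 0, depending only on m and α, such that for every integrable function g : (0,L) → ℝ which is strictly positive and satisfies g(η₂)/g(η₁) ≤ (η₂/η₁)^{−α} for all 0 < η₁ ≤ η₂ < L, one has ∫_0^L ( cos(mφ/2) − sin(mφ/2) ) g(φ) dφ ≥ c ∫_0^L g(φ) dφ. -/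
open Real MeasureTheory

/-- If `w` is antitone and passes `w p` at `p`, and the ratio `g / k` is non-increasing, then
`∫ (w - w p) g` is at least the corresponding integral of the multiple of `k` that agrees
with `g` at `p`. -/
theorem setIntegral_sub_mul_ge_of_antitoneOn {w g k : ℝ → ℝ} {a b p K : ℝ}
    (hw : AntitoneOn w (Set.Ioo a b)) (hp : p ∈ Set.Ioo a b)
    (hleft : ∀ x ∈ Set.Ioo a b, x ≤ p → K * k x ≤ g x)
    (hright : ∀ x ∈ Set.Ioo a b, p ≤ x → g x ≤ K * k x)
    (hg : IntegrableOn g (Set.Ioo a b)) (hk : IntegrableOn k (Set.Ioo a b))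
    (hwg : IntegrableOn (fun x => w x * g x) (Set.Ioo a b))
    (hwk : IntegrableOn (fun x => w x * k x) (Set.Ioo a b)) :
    K * ((∫ x in Set.Ioo a b, w x * k x) - w p * ∫ x in Set.Ioo a b, k x) ≤
      (∫ x in Set.Ioo a b, w x * g x) - w p * ∫ x in Set.Ioo a b, g x := by
  rw [← integral_const_mul, ← integral_const_mul, ← integral_sub hwk (hk.const_mul _),
    ← integral_sub hwg (hg.const_mul _), ← integral_const_mul]
  refine setIntegral_mono_on ((hwk.sub (hk.const_mul _)).const_mul K)
    (hwg.sub (hg.const_mul _)) measurableSet_Ioo fun x hx => ?_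
  rcases le_total x p with h | h
  · nlinarith [mul_nonneg (sub_nonneg.2 (hw hx hp h)) (sub_nonneg.2 (hleft x hx h))]
  · nlinarith [mul_nonneg (sub_nonneg.2 (hw hp hx h)) (sub_nonneg.2 (hright x hx h))]

/-- A strictly decreasing weight of zero mean has positive integral against a negative power. -/
theorem setIntegral_mul_rpow_neg_pos {w : ℝ → ℝ} {α L q : ℝ} (hα : 0 < α)
    (hw : StrictAntiOn w (Set.Ioo 0 L)) (hq : q ∈ Set.Ioo 0 L) (hwq : w q = 0)
    (hwint : IntegrableOn w (Set.Ioo 0 L)) (hmean : ∫ x in Set.Ioo 0 L, w x = 0)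
    (hwk : IntegrableOn (fun x => w x * x ^ (-α)) (Set.Ioo 0 L)) :
    0 < ∫ x in Set.Ioo 0 L, w x * x ^ (-α) := by
  have hint : IntegrableOn (fun x => w x * x ^ (-α) - w x * q ^ (-α)) (Set.Ioo 0 L) :=
    hwk.sub (hwint.mul_const (q ^ (-α)))
  have heq : ∫ x in Set.Ioo 0 L, w x * x ^ (-α) =
      ∫ x in Set.Ioo 0 L, (w x * x ^ (-α) - w x * q ^ (-α)) := by
    rw [integral_sub hwk (hwint.mul_const _), integral_mul_const, hmean]
    simp
  have hpos : ∀ x ∈ Set.Ioo 0 q, 0 < w x * x ^ (-α) - w x * q ^ (-α) := fun x hx => by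
    have h1 := hw ⟨hx.1, hx.2.trans hq.2⟩ hq hx.2
    have h2 := Real.rpow_lt_rpow_of_neg hx.1 hx.2 (neg_lt_zero.2 hα)
    rw [← mul_sub]
    exact mul_pos (by linarith) (by linarith)
  rw [heq, setIntegral_pos_iff_support_of_nonneg_ae _ hint]
  · refine lt_of_lt_of_le ?_ (measure_mono (s := Set.Ioo 0 q) fun x hx =>
      ⟨(hpos x hx).ne', hx.1, hx.2.trans hq.2⟩)
    simpa using hq.1
  · refine (ae_restrict_iff' measurableSet_Ioo).2 (.of_forall fun x hx => ?_)
    rcases lt_or_ge x q with h | h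
    · exact (hpos x ⟨hx.1, h⟩).le
    · have h1 := hw.antitoneOn hq hx h
      have h2 := Real.rpow_le_rpow_of_nonpos hq.1 h (neg_nonpos.2 hα.le)
      simp only [Pi.zero_apply]
      rw [← mul_sub]
      exact mul_nonneg_of_nonpos_of_nonpos (by linarith) (by linarith)

theorem strictAntiOn_cos_sub_sin_mul_half {m : ℝ} (hm : 0 < m) :
    StrictAntiOn (fun φ => Real.cos (m * φ / 2) - Real.sin (m * φ / 2))
      (Set.Icc 0 (π / m)) := by
  intro x hx y hy hxy
  have hmx : 0 ≤ m * x / 2 := div_nonneg (mul_nonneg hm.le hx.1) two_pos.le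
  have hmy : m * y ≤ π := by
    have := (le_div_iff₀ hm).1 hy.2
    linarith
  have hlt : m * x / 2 < m * y / 2 := by gcongr
  have h1 := Real.cos_lt_cos_of_nonneg_of_le_pi hmx (by linarith [Real.pi_pos]) hlt
  have h2 := Real.sin_lt_sin_of_lt_of_le_pi_div_two (by linarith [Real.pi_pos])
    (by linarith) hlt
  simp only
  linarith

theorem setIntegral_cos_sub_sin_mul_half {m : ℝ} (hm : 0 < m) :
    ∫ φ in Set.Ioo 0 (π / m), (Real.cos (m * φ / 2) - Real.sin (m * φ / 2)) = 0 := by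
  rw [← integral_Ioc_eq_integral_Ioo, ← intervalIntegral.integral_of_le (by positivity)]
  have hderiv : ∀ x : ℝ, HasDerivAt
      (fun φ => 2 / m * (Real.sin (m * φ / 2) + Real.cos (m * φ / 2)))
      (Real.cos (m * x / 2) - Real.sin (m * x / 2)) x := fun x => by
    have h : HasDerivAt (fun φ : ℝ => m * φ / 2) (m / 2) x := by
      simpa using ((hasDerivAt_id x).const_mul m).div_const 2
    refine ((h.sin.add h.cos).const_mul (2 / m)).congr_deriv ?_
    field_simp
    ring
  rw [intervalIntegral.integral_eq_sub_of_hasDerivAt (fun x _ => hderiv x)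
    (Continuous.intervalIntegrable (by fun_prop) _ _), mul_div_cancel₀ _ hm.ne']
  simp

theorem exists_pos_lt_one_mul_le {A B : ℝ} (hA : 0 < A) (hB : 0 ≤ B) :
    ∃ c : ℝ, 0 < c ∧ c < 1 ∧ c * B ≤ A := by
  refine ⟨min (A / (B + 1)) (1 / 2), by positivity,
    (min_le_right _ _).trans_lt (by norm_num), ?_⟩
  calc min (A / (B + 1)) (1 / 2) * B ≤ A / (B + 1) * (B + 1) :=
        mul_le_mul (min_le_left _ _) (by linarith) hB (by positivity)
    _ = A := div_mul_cancel₀ _ (by positivity)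

/-- **Key quantitative lower bound in the blow-up argument of Theorem 1.3.** For functions
`g > 0` on `(0, π/m)` satisfying the power-law ratio bound `g(η₂)/g(η₁) ≤ (η₂/η₁)^{−α}`,
the signed integral of `(cos(mφ/2) − sin(mφ/2)) g` controls a positive multiple of the
total mass of `g`. -/
theorem signed_integral_lower_bound (m : ℕ) (hm : 3 ≤ m) (α : ℝ) (hα0 : 0 < α)
    (hα1 : α < 1) :
    ∃ c : ℝ, 0 < c ∧ ∀ g : ℝ → ℝ, IntegrableOn g (Set.Ioo 0 (π / m)) →
      (∀ φ ∈ Set.Ioo (0 : ℝ) (π / m), 0 < g φ) →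
      (∀ η₁ η₂ : ℝ, 0 < η₁ → η₁ ≤ η₂ → η₂ < π / m → g η₂ / g η₁ ≤ (η₂ / η₁) ^ (-α)) →
      c * ∫ φ in Set.Ioo (0 : ℝ) (π / m), g φ ≤
        ∫ φ in Set.Ioo (0 : ℝ) (π / m),
          (Real.cos ((m : ℝ) * φ / 2) - Real.sin ((m : ℝ) * φ / 2)) * g φ := by
  have hm0 : (0 : ℝ) < m := by exact_mod_cast (by omega : 0 < m)
  set L : ℝ := π / m
  have hLpos : 0 < L := by positivity
  have hmL : (m : ℝ) * L = π := mul_div_cancel₀ _ hm0.ne'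
  set w : ℝ → ℝ := fun φ => Real.cos ((m : ℝ) * φ / 2) - Real.sin ((m : ℝ) * φ / 2) with hw
  have hwcont : Continuous w := by fun_prop
  have hwanti : StrictAntiOn w (Set.Icc 0 L) := strictAntiOn_cos_sub_sin_mul_half hm0
  have hw0 : w 0 = 1 := by simp [hw]
  have hwL : w L = -1 := by simp [hw, hmL]
  have hwq : w (L / 2) = 0 := by
    have : (m : ℝ) * (L / 2) / 2 = π / 4 := by rw [← hmL]; ring
    simp [hw, this]
  have hmulint : ∀ f : ℝ → ℝ, IntegrableOn f (Set.Ioo 0 L) →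
      IntegrableOn (fun x => w x * f x) (Set.Ioo 0 L) := fun f hf =>
    hf.bdd_mul (c := 2) hwcont.aestronglyMeasurable <| .of_forall fun x => by
      rw [Real.norm_eq_abs, abs_le]
      constructor <;> linarith [Real.neg_one_le_cos (m * x / 2), Real.cos_le_one (m * x / 2),
        Real.neg_one_le_sin (m * x / 2), Real.sin_le_one (m * x / 2)]
  have hk : IntegrableOn (fun x : ℝ => x ^ (-α)) (Set.Ioo 0 L) :=
    (intervalIntegrable_iff_integrableOn_Ioo_of_le hLpos.le).1
      (intervalIntegral.intervalIntegrable_rpow' (by linarith))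
  have hA := setIntegral_mul_rpow_neg_pos hα0 (hwanti.mono Set.Ioo_subset_Icc_self)
    ⟨half_pos hLpos, half_lt_self hLpos⟩ hwq
    ((intervalIntegrable_iff_integrableOn_Ioo_of_le hLpos.le).1
      (hwcont.intervalIntegrable _ _))
    (setIntegral_cos_sub_sin_mul_half hm0) (hmulint _ hk)
  set A : ℝ := ∫ x in Set.Ioo 0 L, w x * x ^ (-α)
  set B : ℝ := ∫ x in Set.Ioo 0 L, x ^ (-α)
  have hB : 0 ≤ B := setIntegral_nonneg measurableSet_Ioo fun x hx => by
    have := hx.1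
    positivity
  obtain ⟨c, hc0, hc1, hcB⟩ := exists_pos_lt_one_mul_le hA hB
  obtain ⟨p, hp, hpc⟩ : ∃ p ∈ Set.Ioo 0 L, w p = c :=
    intermediate_value_Ioo' hLpos.le hwcont.continuousOn
      ⟨by rw [hwL]; linarith, by rw [hw0]; exact hc1⟩
  refine ⟨c, hc0, fun g hg hgpos hratio => ?_⟩
  have hle : ∀ x y : ℝ, 0 < x → x ≤ y → y < L →
      g y * y ^ α ≤ g x * x ^ α := fun x y hx hxy hy => by
    have hy0 := hx.trans_le hxy
    have h := hratio x y hx hxy hy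
    rw [Real.rpow_neg (by positivity), Real.div_rpow hy0.le hx.le, inv_div,
      div_le_div_iff₀ (hgpos x ⟨hx, hxy.trans_lt hy⟩) (by positivity)] at h
    linarith
  have hmain := setIntegral_sub_mul_ge_of_antitoneOn (K := g p * p ^ α)
    (hwanti.antitoneOn.mono Set.Ioo_subset_Icc_self) hp
    (fun x hx hxp => by
      have := Real.rpow_pos_of_pos hx.1 α
      rw [Real.rpow_neg hx.1.le, ← div_eq_mul_inv, div_le_iff₀ this]
      exact hle x p hx.1 hxp hp.2)
    (fun x hx hpx => by
      have := Real.rpow_pos_of_pos hx.1 α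
      rw [Real.rpow_neg hx.1.le, ← div_eq_mul_inv, le_div_iff₀ this]
      exact hle p x hp.1 hpx hx.2)
    hg hk (hmulint g hg) (hmulint _ hk)
  have hK : 0 ≤ g p * p ^ α :=
    mul_nonneg (hgpos p hp).le (Real.rpow_nonneg hp.1.le α)
  rw [hpc] at hmain
  exact sub_nonneg.1 ((mul_nonneg hK (sub_nonneg.2 hcB)).trans hmain)
end

section
/- Let m ≥ 3 be an integer, L = π/m, 0 < α < 1, and set B = 3m²/(4(m²−4)). There exists a constant c > 0 depending only on m and α such that the following holds. Let T ∈ (0,∞], and let g : [0,T) × (0,L) → ℝ be such that for each t ∈ [0,T) the function g(t,·) is integrable, strictly positive, and satisfies g(t,η₂)/g(t,η₁) ≤ (η₂/η₁)^{−α} for all 0 < η₁ ≤ η₂ < L. Suppose furthermore that I(t) := ∫_0^L g(t,θ) dθ is differentiable on [0,T) with I'(t) = ( B ∫_0^L (cos(mφ/2) + sin(mφ/2)) g(t,φ) dφ ) · ( B ∫_0^L (cos(mφ/2) − sin(mφ/2)) g(t,φ) dφ ) for all t. Then I'(t) ≥ c I(t)² for every t ∈ [0,T), and consequently T ≤ 1/(c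 I(0)); in particular no such g exists with T = ∞. (This is the Riccati-type differential inequality that produces the finite-time blow-up of Theorem 1.3.) -/
open Real MeasureTheory

open intervalIntegral in
/-- Chebyshev-type comparison of a function decaying at least like `θ ^ (-α)` with that power. -/
theorem integral_mul_nonneg_of_ratio_le {L α : ℝ} (hL : 0 < L) (hα1 : α < 1)
    {v g : ℝ → ℝ} (hvc : Continuous v) (hv : AntitoneOn v (Set.Icc 0 L))
    (hv0 : 0 < v 0) (hvL : v L < 0) (hvα : 0 ≤ ∫ θ in (0 : ℝ)..L, v θ * θ ^ (-α))
    (hgi : IntervalIntegrable g volume 0 L) (hg : ∀ θ ∈ Set.Ioo 0 L, 0 < g θ)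
    (hr : ∀ η₁ η₂ : ℝ, 0 < η₁ → η₁ ≤ η₂ → η₂ < L → g η₂ / g η₁ ≤ (η₂ / η₁) ^ (-α)) :
    0 ≤ ∫ θ in (0 : ℝ)..L, v θ * g θ := by
  obtain ⟨a, ⟨ha0, haL⟩, hva⟩ : ∃ a ∈ Set.Ioo 0 L, v a = 0 :=
    intermediate_value_Ioo' hL.le hvc.continuousOn ⟨hvL, hv0⟩
  have hga := hg a ⟨ha0, haL⟩
  have hpa : 0 < a ^ (-α) := rpow_pos_of_pos ha0 _
  set k := g a / a ^ (-α) with hk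
  have hk0 : 0 < k := div_pos hga hpa
  have hle : ∫ θ in (0 : ℝ)..L, k * (v θ * θ ^ (-α)) ≤ ∫ θ in (0 : ℝ)..L, v θ * g θ := by
    refine integral_mono_on_of_le_Ioo hL.le
      (((intervalIntegrable_rpow' (by linarith)).continuousOn_mul
        hvc.continuousOn).const_mul k)
      (hgi.continuousOn_mul hvc.continuousOn) fun θ hθ => ?_
    have hgθ := hg θ hθ
    have hpθ : 0 < θ ^ (-α) := rpow_pos_of_pos hθ.1 _
    rcases le_total θ a with h | h
    · have h1 : 0 ≤ v θ :=
        hva ▸ hv ⟨hθ.1.le, hθ.2.le⟩ ⟨ha0.le, haL.le⟩ h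
      have h2 := hr θ a hθ.1 h haL
      rw [div_rpow ha0.le hθ.1.le, div_le_div_iff₀ hgθ hpθ] at h2
      have h3 : k * θ ^ (-α) ≤ g θ := by
        rw [hk, div_mul_eq_mul_div, div_le_iff₀ hpa]
        linarith
      nlinarith
    · have h1 : v θ ≤ 0 :=
        hva ▸ hv ⟨ha0.le, haL.le⟩ ⟨hθ.1.le, hθ.2.le⟩ h
      have h2 := hr a θ ha0 h hθ.2
      rw [div_rpow hθ.1.le ha0.le, div_le_div_iff₀ hga hpa] at h2
      have h3 : g θ ≤ k * θ ^ (-α) := by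
        rw [hk, div_mul_eq_mul_div, le_div_iff₀ hpa]
        linarith
      nlinarith
  rw [intervalIntegral.integral_const_mul] at hle
  exact (mul_nonneg hk0.le hvα).trans hle

open intervalIntegral in
/-- A strictly decreasing weight of zero mean has positive integral against `θ ^ (-α)`. -/
theorem integral_mul_rpow_neg_pos {L α : ℝ} (hL : 0 < L) (hα0 : 0 < α) (hα1 : α < 1)
    {w : ℝ → ℝ} (hwc : Continuous w) (hw : StrictAntiOn w (Set.Icc 0 L))
    (hw0 : 0 < w 0) (hwL : w L < 0) (hwi : ∫ θ in (0 : ℝ)..L, w θ = 0) :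
    0 < ∫ θ in (0 : ℝ)..L, w θ * θ ^ (-α) := by
  obtain ⟨a, ⟨ha0, haL⟩, hwa⟩ : ∃ a ∈ Set.Ioo 0 L, w a = 0 :=
    intermediate_value_Ioo' hL.le hwc.continuousOn ⟨hwL, hw0⟩
  have hint : ∀ b c : ℝ, IntervalIntegrable (fun θ => w θ * (θ ^ (-α) - a ^ (-α))) volume b c :=
    fun b c => ((intervalIntegrable_rpow' (by linarith)).sub
      intervalIntegrable_const).continuousOn_mul hwc.continuousOn
  have hsplit : ∫ θ in (0 : ℝ)..L, w θ * (θ ^ (-α) - a ^ (-α))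
      = ∫ θ in (0 : ℝ)..L, w θ * θ ^ (-α) := by
    simp_rw [mul_sub]
    rw [integral_sub ((intervalIntegrable_rpow' (by linarith)).continuousOn_mul
      hwc.continuousOn) ((hwc.intervalIntegrable _ _).mul_const _),
      intervalIntegral.integral_mul_const, hwi]
    ring
  rw [← hsplit, ← integral_add_adjacent_intervals (hint 0 a) (hint a L)]
  refine add_pos (intervalIntegral_pos_of_pos_on (hint 0 a) (fun θ hθ => ?_) ha0)
    (intervalIntegral_pos_of_pos_on (hint a L) (fun θ hθ => ?_) haL)
  · have h1 := hw ⟨hθ.1.le, hθ.2.le.trans haL.le⟩ ⟨ha0.le, haL.le⟩ hθ.2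
    have h2 := rpow_lt_rpow_of_neg hθ.1 hθ.2 (neg_neg_of_pos hα0)
    exact mul_pos (by linarith) (by linarith)
  · have h1 := hw ⟨ha0.le, haL.le⟩ ⟨ha0.le.trans hθ.1.le, hθ.2.le⟩ hθ.1
    have h2 := rpow_lt_rpow_of_neg ha0 hθ.1 (neg_neg_of_pos hα0)
    exact mul_pos_of_neg_of_neg (by linarith) (by linarith)

open intervalIntegral in
/-- Uniform lower bound of a decreasing weighted integral by the mass. -/
theorem exists_pos_mul_integral_le {L α : ℝ} (hL : 0 < L) (hα0 : 0 < α) (hα1 : α < 1)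
    {w : ℝ → ℝ} (hwc : Continuous w) (hw : StrictAntiOn w (Set.Icc 0 L))
    (hw0 : 0 < w 0) (hwL : w L < 0) (hwi : ∫ θ in (0 : ℝ)..L, w θ = 0) :
    ∃ δ : ℝ, 0 < δ ∧ ∀ g : ℝ → ℝ, IntervalIntegrable g volume 0 L →
      (∀ θ ∈ Set.Ioo 0 L, 0 < g θ) →
      (∀ η₁ η₂ : ℝ, 0 < η₁ → η₁ ≤ η₂ → η₂ < L → g η₂ / g η₁ ≤ (η₂ / η₁) ^ (-α)) →
      δ * ∫ θ in (0 : ℝ)..L, g θ ≤ ∫ θ in (0 : ℝ)..L, w θ * g θ := by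
  have hpi : IntervalIntegrable (fun θ : ℝ => θ ^ (-α)) volume 0 L :=
    intervalIntegrable_rpow' (by linarith)
  have hJ := integral_mul_rpow_neg_pos hL hα0 hα1 hwc hw hw0 hwL hwi
  have hP : 0 < ∫ θ in (0 : ℝ)..L, θ ^ (-α) :=
    intervalIntegral_pos_of_pos_on hpi (fun θ hθ => rpow_pos_of_pos hθ.1 _) hL
  have hsub : ∀ (δ : ℝ) (f : ℝ → ℝ), IntervalIntegrable f volume 0 L →
      ∫ θ in (0 : ℝ)..L, (w θ - δ) * f θ
        = (∫ θ in (0 : ℝ)..L, w θ * f θ) - δ * ∫ θ in (0 : ℝ)..L, f θ := by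
    intro δ f hf
    simp_rw [sub_mul]
    rw [integral_sub (hf.continuousOn_mul hwc.continuousOn) (hf.const_mul δ),
      intervalIntegral.integral_const_mul]
  set δ := min ((∫ θ in (0 : ℝ)..L, w θ * θ ^ (-α)) / ∫ θ in (0 : ℝ)..L, θ ^ (-α)) (w 0 / 2)
  have hδ : 0 < δ := lt_min (div_pos hJ hP) (by linarith)
  have hδ0 : δ ≤ w 0 / 2 := min_le_right _ _
  refine ⟨δ, hδ, fun g hgi hg hr => ?_⟩
  have key := integral_mul_nonneg_of_ratio_le (v := fun θ => w θ - δ) hL hα1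
    (hwc.sub continuous_const) (fun x hx y hy hxy => sub_le_sub_right (hw.antitoneOn hx hy hxy) δ)
    (by linarith) (by linarith) ?_ hgi hg hr
  · rw [hsub δ g hgi] at key
    linarith
  · rw [hsub δ _ hpi, sub_nonneg, ← le_div_iff₀ hP]
    exact min_le_left _ _

/-- Blow-up time bound for positive solutions of `c y² ≤ y'`. -/
theorem le_one_div_of_mul_sq_le_deriv {c t : ℝ} (hc : 0 < c) (ht : 0 ≤ t) {y y' : ℝ → ℝ}
    (hy : ∀ s ∈ Set.Icc 0 t, 0 < y s)
    (hd : ∀ s ∈ Set.Icc 0 t, HasDerivWithinAt y (y' s) (Set.Icc 0 t) s)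
    (hle : ∀ s ∈ Set.Icc 0 t, c * y s ^ 2 ≤ y' s) : t ≤ 1 / (c * y 0) := by
  have hd' : ∀ s ∈ Set.Icc 0 t,
      HasDerivWithinAt (fun s => (y s)⁻¹ + c * s) (-y' s / y s ^ 2 + c * 1) (Set.Icc 0 t) s :=
    fun s hs => ((hd s hs).fun_inv (hy s hs).ne').add ((hasDerivWithinAt_id s _).const_mul c)
  have hanti : AntitoneOn (fun s => (y s)⁻¹ + c * s) (Set.Icc 0 t) := by
    refine antitoneOn_of_hasDerivWithinAt_nonpos (convex_Icc 0 t)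
      (fun s hs => (hd' s hs).continuousWithinAt)
      (fun s hs => (hd' s (interior_subset hs)).mono interior_subset) fun s hs => ?_
    have h1 := hle s (interior_subset hs)
    have h2 : 0 < y s ^ 2 := pow_pos (hy s (interior_subset hs)) 2
    have h3 := (le_div_iff₀ h2).2 h1
    rw [neg_div]
    linarith
  have h := hanti (Set.left_mem_Icc.2 ht) (Set.right_mem_Icc.2 ht) ht
  have hyt := inv_pos.2 (hy t (Set.right_mem_Icc.2 ht))
  have hy0 := hy 0 (Set.left_mem_Icc.2 ht)
  have h' : c * t ≤ (y 0)⁻¹ := by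
    simp only [mul_zero, add_zero] at h
    linarith
  rw [le_div_iff₀ (mul_pos hc hy0)]
  calc t * (c * y 0) = c * t * y 0 := by ring
    _ ≤ (y 0)⁻¹ * y 0 := mul_le_mul_of_nonneg_right h' hy0.le
    _ = 1 := inv_mul_cancel₀ hy0.ne'

theorem strictAntiOn_cos_sub_sin {m : ℝ} (hm : 0 < m) :
    StrictAntiOn (fun φ : ℝ => cos (m * φ / 2) - sin (m * φ / 2)) (Set.Icc 0 (π / m)) := by
  intro x hx y hy hxy
  have hy2 := (le_div_iff₀ hm).1 hy.2
  have h0 : 0 ≤ m * x := mul_nonneg hm.le hx.1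
  have h1 : m * x < m * y := mul_lt_mul_of_pos_left hxy hm
  have hc : cos (m * y / 2) < cos (m * x / 2) :=
    cos_lt_cos_of_nonneg_of_le_pi_div_two (by linarith) (by linarith) (by linarith)
  have hs : sin (m * x / 2) < sin (m * y / 2) :=
    sin_lt_sin_of_lt_of_le_pi_div_two (by linarith [pi_pos]) (by linarith) (by linarith)
  exact sub_lt_sub hc hs

theorem integral_cos_sub_sin_eq_zero {m : ℝ} (hm : 0 < m) :
    ∫ φ in (0 : ℝ)..π / m, (cos (m * φ / 2) - sin (m * φ / 2)) = 0 := by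
  have hd : ∀ φ : ℝ, HasDerivAt
      (fun φ : ℝ => 2 / m * (sin (m * φ / 2) + cos (m * φ / 2)))
      (cos (m * φ / 2) - sin (m * φ / 2)) φ := by
    intro φ
    have hl : HasDerivAt (fun φ : ℝ => m * φ / 2) (m / 2) φ := by
      simpa using ((hasDerivAt_id φ).const_mul m).div_const 2
    refine ((hl.sin.add hl.cos).const_mul (2 / m)).congr_deriv ?_
    field_simp
    ring
  rw [intervalIntegral.integral_eq_sub_of_hasDerivAt (fun φ _ => hd φ)
    (Continuous.intervalIntegrable (by fun_prop) _ _), mul_div_cancel₀ _ hm.ne']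
  simp

theorem one_le_cos_add_sin {x : ℝ} (h0 : 0 ≤ x) (h1 : x ≤ π / 2) : 1 ≤ cos x + sin x := by
  have hc := cos_nonneg_of_mem_Icc ⟨by linarith, h1⟩
  have hs := sin_nonneg_of_nonneg_of_le_pi h0 (by linarith [pi_pos])
  nlinarith [sin_sq_add_cos_sq x, mul_nonneg hc hs]

/-- **Riccati-type differential inequality producing the blow-up of Theorem 1.3.**
With `B = 3m²/(4(m²−4))`, for any solution-like family `g(t,·)` on `[0,T)` (with
`T ∈ (0,∞]`, modeled as an extended real) which is positive, integrable, satisfies the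
propagated power-law ratio bound, and whose mass `I(t) = ∫_0^L g(t,θ) dθ` has derivative
`(B ∫ (cos+sin) g)(B ∫ (cos−sin) g)`, one has `I' ≥ c I²` on `[0,T)` and hence
`T ≤ 1/(c I(0))`; in particular `T ≠ ∞`. -/
theorem riccati_blowup (m : ℕ) (hm : 3 ≤ m) (α : ℝ) (hα0 : 0 < α) (hα1 : α < 1) :
    ∃ c : ℝ, 0 < c ∧ ∀ T : EReal, 0 < T → ∀ g : ℝ → ℝ → ℝ,
      (∀ t : ℝ, 0 ≤ t → (t : EReal) < T →
        IntegrableOn (g t) (Set.Ioo 0 (π / m)) ∧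
        (∀ θ ∈ Set.Ioo (0 : ℝ) (π / m), 0 < g t θ) ∧
        (∀ η₁ η₂ : ℝ, 0 < η₁ → η₁ ≤ η₂ → η₂ < π / m →
          g t η₂ / g t η₁ ≤ (η₂ / η₁) ^ (-α))) →
      (∀ t : ℝ, 0 ≤ t → (t : EReal) < T →
        HasDerivWithinAt (fun τ => ∫ θ in Set.Ioo (0 : ℝ) (π / m), g τ θ)
          ((3 * (m : ℝ) ^ 2 / (4 * ((m : ℝ) ^ 2 - 4)) *
              ∫ φ in Set.Ioo (0 : ℝ) (π / m),
                (Real.cos ((m : ℝ) * φ / 2) + Real.sin ((m : ℝ) * φ / 2)) * g t φ) *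
            (3 * (m : ℝ) ^ 2 / (4 * ((m : ℝ) ^ 2 - 4)) *
              ∫ φ in Set.Ioo (0 : ℝ) (π / m),
                (Real.cos ((m : ℝ) * φ / 2) - Real.sin ((m : ℝ) * φ / 2)) * g t φ))
          {τ : ℝ | 0 ≤ τ ∧ (τ : EReal) < T} t) →
      (∀ t : ℝ, 0 ≤ t → (t : EReal) < T →
        c * (∫ θ in Set.Ioo (0 : ℝ) (π / m), g t θ) ^ 2 ≤
          (3 * (m : ℝ) ^ 2 / (4 * ((m : ℝ) ^ 2 - 4)) *
              ∫ φ in Set.Ioo (0 : ℝ) (π / m),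
                (Real.cos ((m : ℝ) * φ / 2) + Real.sin ((m : ℝ) * φ / 2)) * g t φ) *
            (3 * (m : ℝ) ^ 2 / (4 * ((m : ℝ) ^ 2 - 4)) *
              ∫ φ in Set.Ioo (0 : ℝ) (π / m),
                (Real.cos ((m : ℝ) * φ / 2) - Real.sin ((m : ℝ) * φ / 2)) * g t φ)) ∧
      T ≤ ((1 / (c * ∫ θ in Set.Ioo (0 : ℝ) (π / m), g 0 θ) : ℝ) : EReal) ∧ T ≠ ⊤ := by
  have hm3 : (3 : ℝ) ≤ m := by exact_mod_cast hm
  have hm0 : (0 : ℝ) < m := by linarith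
  have hL : 0 < π / m := div_pos pi_pos hm0
  set B : ℝ := 3 * (m : ℝ) ^ 2 / (4 * ((m : ℝ) ^ 2 - 4))
  have hB : 0 < B := div_pos (by positivity) (by nlinarith)
  have hIoo : ∀ f : ℝ → ℝ, ∫ φ in Set.Ioo (0 : ℝ) (π / m), f φ = ∫ φ in (0 : ℝ)..π / m, f φ :=
    fun f => by rw [intervalIntegral.integral_of_le hL.le, integral_Ioc_eq_integral_Ioo]
  simp_rw [hIoo]
  obtain ⟨δ, hδ, hδg⟩ := exists_pos_mul_integral_le hL hα0 hα1
    (w := fun φ : ℝ => cos (m * φ / 2) - sin (m * φ / 2)) (by fun_prop)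
    (strictAntiOn_cos_sub_sin hm0) (by simp) (by simp [mul_div_cancel₀ _ hm0.ne'])
    (integral_cos_sub_sin_eq_zero hm0)
  have hc : 0 < B ^ 2 * δ := by positivity
  refine ⟨B ^ 2 * δ, hc, fun T hT g hg hd => ?_⟩
  have hgi : ∀ t : ℝ, 0 ≤ t → (t : EReal) < T → IntervalIntegrable (g t) volume 0 (π / m) :=
    fun t h0 h1 => (intervalIntegrable_iff_integrableOn_Ioo_of_le hL.le).2 (hg t h0 h1).1
  have hpos : ∀ t : ℝ, 0 ≤ t → (t : EReal) < T → 0 < ∫ θ in (0 : ℝ)..π / m, g t θ :=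
    fun t h0 h1 => intervalIntegral.intervalIntegral_pos_of_pos_on (hgi t h0 h1)
      (hg t h0 h1).2.1 hL
  have hric : ∀ t : ℝ, 0 ≤ t → (t : EReal) < T →
      B ^ 2 * δ * (∫ θ in (0 : ℝ)..π / m, g t θ) ^ 2 ≤
        (B * ∫ φ in (0 : ℝ)..π / m, (cos (m * φ / 2) + sin (m * φ / 2)) * g t φ) *
          (B * ∫ φ in (0 : ℝ)..π / m, (cos (m * φ / 2) - sin (m * φ / 2)) * g t φ) := by
    intro t h0 h1
    have hI := hpos t h0 h1
    have hminus := hδg (g t) (hgi t h0 h1) (hg t h0 h1).2.1 (hg t h0 h1).2.2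
    have hplus : ∫ θ in (0 : ℝ)..π / m, g t θ ≤
        ∫ φ in (0 : ℝ)..π / m, (cos (m * φ / 2) + sin (m * φ / 2)) * g t φ := by
      refine intervalIntegral.integral_mono_on_of_le_Ioo hL.le (hgi t h0 h1)
        ((hgi t h0 h1).continuousOn_mul (by fun_prop)) fun φ hφ => ?_
      have hφ2 := (lt_div_iff₀ hm0).1 hφ.2
      exact le_mul_of_one_le_left ((hg t h0 h1).2.1 φ hφ).le
        (one_le_cos_add_sin (by have := mul_pos hm0 hφ.1; linarith) (by linarith))
    calc B ^ 2 * δ * (∫ θ in (0 : ℝ)..π / m, g t θ) ^ 2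
        = (B * ∫ θ in (0 : ℝ)..π / m, g t θ) * (B * (δ * ∫ θ in (0 : ℝ)..π / m, g t θ)) := by
          ring
      _ ≤ _ := mul_le_mul (mul_le_mul_of_nonneg_left hplus hB.le)
          (mul_le_mul_of_nonneg_left hminus hB.le) (by positivity)
          (mul_nonneg hB.le (hI.le.trans hplus))
  have hT' : T ≤ ((1 / (B ^ 2 * δ * ∫ θ in (0 : ℝ)..π / m, g 0 θ) : ℝ) : EReal) := by
    by_contra! hlt
    obtain ⟨t, hRt, htT⟩ := EReal.lt_iff_exists_real_btwn.1 hlt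
    have hRt' := EReal.coe_lt_coe_iff.1 hRt
    have ht0 : 0 ≤ t :=
      (one_div_pos.2 (mul_pos hc (hpos 0 le_rfl (by simpa using hT)))).le.trans hRt'.le
    have hlt' : ∀ s ∈ Set.Icc 0 t, (s : EReal) < T :=
      fun s hs => (EReal.coe_le_coe_iff.2 hs.2).trans_lt htT
    exact hRt'.not_ge (le_one_div_of_mul_sq_le_deriv hc ht0
      (y := fun τ => ∫ θ in (0 : ℝ)..π / m, g τ θ)
      (fun s hs => hpos s hs.1 (hlt' s hs))
      (fun s hs => (hd s hs.1 (hlt' s hs)).mono fun τ hτ => ⟨hτ.1, hlt' τ hτ⟩)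
      (fun s hs => hric s hs.1 (hlt' s hs)))
  exact ⟨hric, hT', (hT'.trans_lt (EReal.coe_lt_top _)).ne⟩
end
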